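/- arXiv:1409.4508 — 3 statements merged into one kernel-verified Lean document; each statement's English description precedes it below -/
import Mathlib

section
/- Let d ≥ 2 and let λ satisfy d^(1/d) − 1 ≤ λ ≤ √2 − 1, and set ℓ = 1 + λ. Then for every packing of n > 1 unit balls in E^d with centers c_1, …, c_n, one has n·ω_d / vol_d(⋃_{i=1}^n (c_i + ℓB^d)) ≤ ((2d + 4)/((2 − ℓ²)d + 4))·ℓ^(−d), and moreover ((2d + 4)/((2 − ℓ²)d + 4))·ℓ^(−d) ≤ ((d + 2)/2)·ℓ^(−d) ≤ 1. -/
open MeasureTheory Metric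

lemma aux_point {d n : ℕ} (c : Fin n → EuclideanSpace ℝ (Fin d))
    (hc : ∀ j k : Fin n, j ≠ k → 2 ≤ ‖c j - c k‖) (x : EuclideanSpace ℝ (Fin d))
    (S : Finset (Fin n)) (hS : S.Nonempty) :
    ∑ i ∈ S, (1 - ‖x - c i‖ ^ 2 / 2) ≤ 1 := by
  have h1 : ∑ i ∈ S, ∑ j ∈ S, ‖(x - c i) - (x - c j)‖ ^ 2
      = 2 * S.card * ∑ i ∈ S, ‖x - c i‖ ^ 2 - 2 * ‖∑ i ∈ S, (x - c i)‖ ^ 2 := by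
    have h2 : ‖∑ i ∈ S, (x - c i)‖ ^ 2
        = ∑ i ∈ S, ∑ j ∈ S, inner ℝ (x - c i) (x - c j) := by
      rw [← real_inner_self_eq_norm_sq, sum_inner]
      simp_rw [inner_sum]
    rw [h2]
    simp_rw [norm_sub_sq_real (x - c _) (x - c _), Finset.sum_add_distrib,
      Finset.sum_sub_distrib, ← Finset.mul_sum, Finset.sum_const, nsmul_eq_mul, ← Finset.mul_sum]
    ring
  have h3 : ∑ i ∈ S, ∑ j ∈ S, (4 - if i = j then (4 : ℝ) else 0)
      ≤ ∑ i ∈ S, ∑ j ∈ S, ‖(x - c i) - (x - c j)‖ ^ 2 := by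
    refine Finset.sum_le_sum fun i _ => Finset.sum_le_sum fun j _ => ?_
    split_ifs with h
    · simp
    · have h4 := hc j i (Ne.symm h)
      have h5 : (x - c i) - (x - c j) = c j - c i := by abel
      rw [h5]
      nlinarith
  have h6 : ∑ i ∈ S, ∑ j ∈ S, (4 - if i = j then (4 : ℝ) else 0)
      = 4 * S.card * S.card - 4 * S.card := by
    have h7 : ∀ i ∈ S, ∑ j ∈ S, (4 - if i = j then (4 : ℝ) else 0) = 4 * S.card - 4 := by
      intro i hi
      rw [Finset.sum_sub_distrib, Finset.sum_ite_eq]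
      simp [hi]
      ring
    rw [Finset.sum_congr rfl h7]
    simp
    ring
  have hm : (0 : ℝ) < S.card := by exact_mod_cast hS.card_pos
  rw [Finset.sum_sub_distrib, ← Finset.sum_div]
  simp only [Finset.sum_const, nsmul_eq_mul, mul_one]
  set T := ∑ i ∈ S, ‖x - c i‖ ^ 2
  have h8 : (S.card : ℝ) * (4 * S.card - 4) ≤ S.card * (2 * T) := by
    nlinarith [sq_nonneg ‖∑ i ∈ S, (x - c i)‖]
  have h9 := le_of_mul_le_mul_left h8 hm
  linarith

/-- The truncated Blichfeldt gauge. -/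
noncomputable def gauge_fn (l : ℝ) : ℝ → ℝ := Set.indicator (Set.Iic l) fun y => 1 - y ^ 2 / 2

lemma gauge_eq {d : ℕ} (l : ℝ) (a : EuclideanSpace ℝ (Fin d)) :
    (fun x => gauge_fn l ‖x - a‖)
      = Set.indicator (closedBall a l) fun x => 1 - ‖x - a‖ ^ 2 / 2 := by
  ext x
  simp [gauge_fn, Set.indicator, dist_eq_norm]

lemma gauge_integrable {d : ℕ} (l : ℝ) (a : EuclideanSpace ℝ (Fin d)) :
    Integrable (fun x => gauge_fn l ‖x - a‖) := by
  rw [gauge_eq, integrable_indicator_iff measurableSet_closedBall]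
  apply ContinuousOn.integrableOn_compact (isCompact_closedBall a l)
  fun_prop

lemma gauge_integral {d : ℕ} (hd : 2 ≤ d) (l : ℝ) (hl : 0 ≤ l) (a : EuclideanSpace ℝ (Fin d)) :
    ∫ x, gauge_fn l ‖x - a‖
      = (volume (closedBall (0 : EuclideanSpace ℝ (Fin d)) 1)).toReal * l ^ d *
        (((2 - l ^ 2) * d + 4) / (2 * d + 4)) := by
  have : Nontrivial (EuclideanSpace ℝ (Fin d)) := by
    have : Nonempty (Fin d) := ⟨⟨0, by omega⟩⟩
    infer_instance
  rw [integral_sub_right_eq_self (fun x => gauge_fn l ‖x‖) a,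
    integral_fun_norm_addHaar, Measure.addHaar_closedBall_eq_addHaar_ball]
  have h1 : ∫ y in Set.Ioi (0 : ℝ), y ^ (Module.finrank ℝ (EuclideanSpace ℝ (Fin d)) - 1)
      • gauge_fn l y = ∫ y in (0 : ℝ)..l, (y ^ (d - 1) - y ^ (d + 1) / 2) := by
    rw [intervalIntegral.integral_of_le hl, ← Set.Ioi_inter_Iic,
      ← setIntegral_indicator measurableSet_Iic]
    congr 1
    ext y
    obtain ⟨k, rfl⟩ : ∃ k, d = k + 1 := ⟨d - 1, by omega⟩
    simp only [gauge_fn, Set.indicator, finrank_euclideanSpace_fin, smul_eq_mul]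
    split_ifs
    · simp only [Nat.add_sub_cancel]; ring
    · simp
  rw [h1, intervalIntegral.integral_sub (by apply Continuous.intervalIntegrable; fun_prop)
    (by apply Continuous.intervalIntegrable; fun_prop), intervalIntegral.integral_div,
    integral_pow, integral_pow, finrank_euclideanSpace_fin]
  obtain ⟨k, rfl⟩ : ∃ k, d = k + 1 := ⟨d - 1, by omega⟩
  simp only [Nat.add_sub_cancel, nsmul_eq_mul, smul_eq_mul, Measure.real]
  push_cast
  have : (k : ℝ) + 1 ≠ 0 := by positivity
  have : (k : ℝ) + 1 + 1 + 1 ≠ 0 := by positivity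
  have : 2 * ((k : ℝ) + 1) + 4 ≠ 0 := by positivity
  simp only [ne_eq, Nat.add_eq_zero_iff, one_ne_zero, and_false, not_false_eq_true, zero_pow]
  field_simp
  ring

/-- Blichfeldt-type bound: if `d ≥ 2`, `d^(1/d) - 1 ≤ λ ≤ √2 - 1` and `ℓ = 1 + λ`, then for
every packing of `n > 1` unit balls in `E^d` with centers `c 1, …, c n`, the density
`n·ω_d / vol_d(⋃ (c i + ℓ B^d))` is at most `((2d+4)/((2-ℓ²)d+4))·ℓ^(-d)`, and moreover
`((2d+4)/((2-ℓ²)d+4))·ℓ^(-d) ≤ ((d+2)/2)·ℓ^(-d) ≤ 1`. -/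
theorem blichfeldt_type_density_bound (d : ℕ) (hd : 2 ≤ d) (lam : ℝ)
    (hlam1 : (d : ℝ) ^ ((1 : ℝ) / d) - 1 ≤ lam) (hlam2 : lam ≤ Real.sqrt 2 - 1)
    (n : ℕ) (hn : 1 < n) (c : Fin n → EuclideanSpace ℝ (Fin d))
    (hc : ∀ j k : Fin n, j ≠ k → 2 ≤ ‖c j - c k‖) :
    (n : ℝ) * (volume (closedBall (0 : EuclideanSpace ℝ (Fin d)) 1)).toReal /
        (volume (⋃ i : Fin n, closedBall (c i) (1 + lam))).toReal ≤
      (2 * d + 4) / ((2 - (1 + lam) ^ 2) * d + 4) * (1 + lam) ^ (-(d : ℝ)) ∧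
    (2 * d + 4) / ((2 - (1 + lam) ^ 2) * d + 4) * (1 + lam) ^ (-(d : ℝ)) ≤
      ((d : ℝ) + 2) / 2 * (1 + lam) ^ (-(d : ℝ)) ∧
    ((d : ℝ) + 2) / 2 * (1 + lam) ^ (-(d : ℝ)) ≤ 1 := by
  set l := 1 + lam with hldef
  have hd0 : (2 : ℝ) ≤ d := by exact_mod_cast hd
  have hl1 : (d : ℝ) ^ ((1 : ℝ) / d) ≤ l := by linarith
  have hl2 : l ≤ Real.sqrt 2 := by linarith
  have hr : 0 < (d : ℝ) ^ ((1 : ℝ) / d) := Real.rpow_pos_of_pos (by linarith) _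
  have hl0 : 0 < l := by linarith
  have hsq : l ^ 2 ≤ 2 := by
    have := pow_le_pow_left₀ hl0.le hl2 2
    rwa [Real.sq_sqrt (by norm_num)] at this
  have hdl : (d : ℝ) ≤ l ^ d := by
    have := pow_le_pow_left₀ hr.le hl1 d
    rwa [one_div, Real.rpow_inv_natCast_pow (by linarith) (by omega)] at this
  have hpos : 0 < l ^ d := by positivity
  rw [Real.rpow_neg hl0.le, Real.rpow_natCast]
  have hD : 4 ≤ (2 - l ^ 2) * d + 4 := by nlinarith
  refine ⟨?_, ?_, ?_⟩
  · set U := ⋃ i : Fin n, closedBall (c i) l with hU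
    have hUm : MeasurableSet U := MeasurableSet.iUnion fun i => measurableSet_closedBall
    have hUc : IsCompact U := isCompact_iUnion fun i => isCompact_closedBall _ _
    have hUfin : volume U ≠ ⊤ := hUc.measure_lt_top.ne
    have hUpos : 0 < (volume U).toReal := by
      refine ENNReal.toReal_pos (ne_of_gt ?_) hUfin
      refine lt_of_lt_of_le (measure_closedBall_pos volume (c ⟨0, by omega⟩) hl0) ?_
      exact measure_mono (Set.subset_iUnion (fun i : Fin n => closedBall (c i) l) ⟨0, by omega⟩)
    have key : ∫ x, ∑ i : Fin n, gauge_fn l ‖x - c i‖ ≤ ∫ x, U.indicator (fun _ => (1 : ℝ)) x := by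
      refine integral_mono (integrable_finsetSum _ fun i _ => gauge_integrable l (c i))
        ((integrable_indicator_iff hUm).2 (integrableOn_const hUfin)) ?_
      intro x
      have hs : ∑ i : Fin n, gauge_fn l ‖x - c i‖
          = ∑ i ∈ Finset.univ.filter (fun i => ‖x - c i‖ ≤ l), (1 - ‖x - c i‖ ^ 2 / 2) := by
        rw [Finset.sum_filter]
        simp [gauge_fn, Set.indicator]
      simp only [hs]
      rcases (Finset.univ.filter (fun i => ‖x - c i‖ ≤ l)).eq_empty_or_nonempty with h | h
      · rw [h, Finset.sum_empty]
        exact Set.indicator_nonneg (fun _ _ => zero_le_one) x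
      · have hx : x ∈ U := by
          obtain ⟨i, hi⟩ := h
          simp only [Finset.mem_filter, Finset.mem_univ, true_and] at hi
          exact Set.mem_iUnion.2 ⟨i, by simpa [dist_eq_norm] using hi⟩
        rw [Set.indicator_of_mem hx]
        exact aux_point c hc x _ h
    rw [integral_finsetSum _ (fun i _ => gauge_integrable l (c i)),
      integral_indicator_const _ hUm] at key
    simp only [gauge_integral hd l hl0.le, Finset.sum_const, Finset.card_univ, Fintype.card_fin,
      nsmul_eq_mul, smul_eq_mul, mul_one, Measure.real] at key
    rw [div_le_iff₀ hUpos]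
    set w := (volume (closedBall (0 : EuclideanSpace ℝ (Fin d)) 1)).toReal
    set V := (volume U).toReal
    have hD0 : (2 - l ^ 2) * d + 4 ≠ 0 := by linarith
    have hE0 : (2 * d + 4 : ℝ) ≠ 0 := by positivity
    calc (n : ℝ) * w = (2 * d + 4) / ((2 - l ^ 2) * d + 4) * (l ^ d)⁻¹ *
          (n * (w * l ^ d * (((2 - l ^ 2) * d + 4) / (2 * d + 4)))) := by
          generalize (2 - l ^ 2) * (d : ℝ) + 4 = D at *
          field_simp
      _ ≤ _ := by
          refine mul_le_mul_of_nonneg_left key ?_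
          have : 0 < (2 - l ^ 2) * d + 4 := by linarith
          positivity
  · refine mul_le_mul_of_nonneg_right ?_ (by positivity)
    rw [div_le_div_iff₀ (by linarith) (by norm_num)]
    nlinarith
  · rw [← div_eq_mul_inv, div_le_one hpos]
    linarith
end

section
/- Let 0 < λ < 2/√3 − 1, set ℓ = 1 + λ, let φ₀ = arctan(1/√2) and ψ₀ = −arctan(√(2/3)·tan(5φ₀)). Let T³ = conv{t_1, t_2, t_3, t_4} be a regular 3-simplex of edge length 2 in E³ (so ‖t_i − t_j‖ = 2 for all i ≠ j), and define σ_3(λ) = 4·vol_3(T³ ∩ (t_1 + B³)) / vol_3(T³ ∩ ⋃_{i=1}^4 (t_i + ℓB³)). Then (π − 6ψ₀) / (π − 6ψ₀ + (3π − 18ψ₀)λ − 18ψ₀λ² − (π + 6ψ₀)λ³) < σ_3(λ), and σ_3(λ) < 1. -/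
open MeasureTheory Metric


lemma rb_tri (s : ℝ) (hs : 0 ≤ s) :
    volume {v : ℝ × ℝ | 0 ≤ v.1 ∧ 0 ≤ v.2 ∧ v.1 + v.2 ≤ s} = ENNReal.ofReal (s ^ 2 / 2) := by
  have hm : MeasurableSet {v : ℝ × ℝ | 0 ≤ v.1 ∧ 0 ≤ v.2 ∧ v.1 + v.2 ≤ s} := by
    apply IsClosed.measurableSet
    simp only [Set.ofPred_and]
    refine (isClosed_le (by fun_prop) (by fun_prop)).inter ?_
    exact (isClosed_le (by fun_prop) (by fun_prop)).inter (isClosed_le (by fun_prop) (by fun_prop))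
  rw [Measure.volume_eq_prod, Measure.prod_apply hm]
  have h1 : ∀ x : ℝ, volume (Prod.mk x ⁻¹' {v : ℝ × ℝ | 0 ≤ v.1 ∧ 0 ≤ v.2 ∧ v.1 + v.2 ≤ s})
      = (Set.Icc 0 s).indicator (fun x => ENNReal.ofReal (s - x)) x := by
    intro x
    by_cases hx : x ∈ Set.Icc 0 s
    · rw [Set.indicator_of_mem hx]
      have : (Prod.mk x ⁻¹' {v : ℝ × ℝ | 0 ≤ v.1 ∧ 0 ≤ v.2 ∧ v.1 + v.2 ≤ s}) = Set.Icc 0 (s - x) := by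
        ext y
        simp only [Set.mem_preimage, Set.mem_ofPred_eq, Set.mem_Icc]
        constructor
        · rintro ⟨_, h2, h3⟩; exact ⟨h2, by linarith⟩
        · rintro ⟨h2, h3⟩; exact ⟨hx.1, h2, by linarith⟩
      rw [this, Real.volume_Icc, sub_zero]
    · rw [Set.indicator_of_notMem hx]
      have : (Prod.mk x ⁻¹' {v : ℝ × ℝ | 0 ≤ v.1 ∧ 0 ≤ v.2 ∧ v.1 + v.2 ≤ s}) = ∅ := by
        ext y
        simp only [Set.mem_preimage, Set.mem_ofPred_eq, Set.mem_empty_iff_false, iff_false]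
        rintro ⟨h1, h2, h3⟩
        exact hx ⟨h1, by linarith⟩
      rw [this, measure_empty]
  simp_rw [h1]
  rw [lintegral_indicator measurableSet_Icc, ← ofReal_integral_eq_lintegral_ofReal]
  · rw [integral_Icc_eq_integral_Ioc, ← intervalIntegral.integral_of_le hs]
    congr 1
    rw [intervalIntegral.integral_sub (by simp) (by simp)]
    simp
    ring
  · exact (Continuous.integrableOn_Icc (by fun_prop))
  · filter_upwards [ae_restrict_mem measurableSet_Icc] with x hx
    simpa using hx.2

lemma rb_region (a : ℝ) (ha : 0 ≤ a) (f : ℝ → ℝ) (hf : Continuous f)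
    (h0 : ∀ x ∈ Set.Icc (-a) a, 0 ≤ f x) :
    volume {v : ℝ × ℝ × ℝ | |v.1| ≤ a ∧ 0 ≤ v.2.1 ∧ 0 ≤ v.2.2 ∧ v.2.1 + v.2.2 ≤ f v.1}
      = ENNReal.ofReal (∫ x in (-a)..a, f x ^ 2 / 2) := by
  have hm : MeasurableSet {v : ℝ × ℝ × ℝ | |v.1| ≤ a ∧ 0 ≤ v.2.1 ∧ 0 ≤ v.2.2 ∧
      v.2.1 + v.2.2 ≤ f v.1} := by
    apply IsClosed.measurableSet
    simp only [Set.ofPred_and]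
    refine (isClosed_le (by fun_prop) (by fun_prop)).inter ?_
    refine (isClosed_le (by fun_prop) (by fun_prop)).inter ?_
    exact (isClosed_le (by fun_prop) (by fun_prop)).inter (isClosed_le (by fun_prop) (by fun_prop))
  rw [Measure.volume_eq_prod, Measure.prod_apply hm]
  have h1 : ∀ x : ℝ, volume (Prod.mk x ⁻¹' {v : ℝ × ℝ × ℝ | |v.1| ≤ a ∧ 0 ≤ v.2.1 ∧ 0 ≤ v.2.2 ∧
      v.2.1 + v.2.2 ≤ f v.1})
      = (Set.Icc (-a) a).indicator (fun x => ENNReal.ofReal (f x ^ 2 / 2)) x := by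
    intro x
    by_cases hx : x ∈ Set.Icc (-a) a
    · rw [Set.indicator_of_mem hx, ← rb_tri (f x) (h0 x hx)]
      congr 1
      ext y
      simp only [Set.mem_preimage, Set.mem_ofPred_eq]
      constructor
      · exact fun h => h.2
      · exact fun h => ⟨abs_le.2 hx, h⟩
    · rw [Set.indicator_of_notMem hx]
      have : (Prod.mk x ⁻¹' {v : ℝ × ℝ × ℝ | |v.1| ≤ a ∧ 0 ≤ v.2.1 ∧ 0 ≤ v.2.2 ∧
          v.2.1 + v.2.2 ≤ f v.1}) = ∅ := by
        ext y
        simp only [Set.mem_preimage, Set.mem_ofPred_eq, Set.mem_empty_iff_false, iff_false]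
        rintro ⟨h1, _⟩
        exact hx (abs_le.1 h1)
      rw [this, measure_empty]
  simp_rw [h1]
  rw [lintegral_indicator measurableSet_Icc, ← ofReal_integral_eq_lintegral_ofReal]
  · rw [integral_Icc_eq_integral_Ioc, ← intervalIntegral.integral_of_le (by linarith)]
  · exact (Continuous.integrableOn_Icc (by fun_prop))
  · filter_upwards with x
    positivity

/-- integral of an even function given by a polynomial in `|x|` -/
lemma rb_even (a : ℝ) (ha : 0 ≤ a) (g : ℝ → ℝ) (hg : Continuous g) :
    ∫ x in (-a)..a, g |x| = 2 * ∫ x in (0:ℝ)..a, g x := by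
  have h := intervalIntegral.integral_add_adjacent_intervals (μ := volume)
    (f := fun x => g |x|) (a := -a) (b := 0) (c := a)
    ((by fun_prop : Continuous fun x => g |x|).intervalIntegrable _ _)
    ((by fun_prop : Continuous fun x => g |x|).intervalIntegrable _ _)
  have h2 : ∫ x in (-a)..0, g |x| = ∫ x in (0:ℝ)..a, g |x| := by
    have := intervalIntegral.integral_comp_neg (fun x => g |x|) (a := 0) (b := a)
    simp only [abs_neg, neg_zero] at this
    exact this.symm
  have h3 : ∫ x in (0:ℝ)..a, g |x| = ∫ x in (0:ℝ)..a, g x := by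
    apply intervalIntegral.integral_congr
    intro x hx
    rw [Set.uIcc_of_le ha] at hx
    simp [abs_of_nonneg hx.1]
  rw [← h, h2, h3]; ring

/-- the tetrahedron in coordinates -/
def rbT : Set (ℝ × ℝ × ℝ) :=
  {v | |v.1| ≤ 1 ∧ 0 ≤ v.2.1 ∧ 0 ≤ v.2.2 ∧ v.2.1 + v.2.2 ≤ 1 - |v.1|}

lemma rbT_vol : volume rbT = ENNReal.ofReal (1 / 3) := by
  unfold rbT
  rw [rb_region 1 zero_le_one (fun x => 1 - |x|) (by fun_prop)
    (fun x hx => by simpa using abs_le.2 hx)]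
  rw [rb_even 1 zero_le_one (fun x => (1 - x) ^ 2 / 2) (by fun_prop)]
  congr 1
  have : ∀ x : ℝ, (1 - x) ^ 2 / 2 = 1 / 2 - x + x ^ 2 / 2 := fun x => by ring
  simp_rw [this]
  rw [intervalIntegral.integral_add (Continuous.intervalIntegrable (by fun_prop) _ _)
    (Continuous.intervalIntegrable (by fun_prop) _ _),
    intervalIntegral.integral_sub (Continuous.intervalIntegrable (by fun_prop) _ _)
    (Continuous.intervalIntegrable (by fun_prop) _ _)]
  simp
  norm_num

lemma rbL_vol (lam : ℝ) (h : 0 ≤ lam) :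
    volume {v : ℝ × ℝ × ℝ | |v.1| ≤ lam ∧ 0 ≤ v.2.1 ∧ 0 ≤ v.2.2 ∧
      v.2.1 + v.2.2 ≤ √(((1 + lam) ^ 2 - (1 + |v.1|) ^ 2) / 3)}
    = ENNReal.ofReal ((3 * lam ^ 2 + 2 * lam ^ 3) / 9) := by
  rw [rb_region lam h (fun x => √(((1 + lam) ^ 2 - (1 + |x|) ^ 2) / 3)) (by fun_prop)
    (fun x hx => by positivity)]
  rw [rb_even lam h (fun x => √(((1 + lam) ^ 2 - (1 + x) ^ 2) / 3) ^ 2 / 2) (by fun_prop)]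
  congr 1
  have : ∫ x in (0:ℝ)..lam, √(((1 + lam) ^ 2 - (1 + x) ^ 2) / 3) ^ 2 / 2 =
      ∫ x in (0:ℝ)..lam, ((2 * lam + lam ^ 2) / 6 - x * (1 / 3) - x ^ 2 / 6) := by
    apply intervalIntegral.integral_congr
    intro x hx
    rw [Set.uIcc_of_le h] at hx
    have : 0 ≤ ((1 + lam) ^ 2 - (1 + x) ^ 2) / 3 := by
      have := hx.1
      have := hx.2
      apply div_nonneg _ (by norm_num)
      nlinarith
    simp only [Real.sq_sqrt this]
    ring
  rw [this, intervalIntegral.integral_sub (Continuous.intervalIntegrable (by fun_prop) _ _)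
    (Continuous.intervalIntegrable (by fun_prop) _ _),
    intervalIntegral.integral_sub (Continuous.intervalIntegrable (by fun_prop) _ _)
    (Continuous.intervalIntegrable (by fun_prop) _ _)]
  simp
  ring

lemma rb_num : Real.pi < 2 * (Real.pi - 6 * (-Real.arctan (Real.sqrt (2 / 3) *
        Real.tan (5 * Real.arctan (1 / Real.sqrt 2))))) := by
  have hs : √2 * √2 = 2 := Real.mul_self_sqrt (by norm_num)
  have hs0 : 0 < √2 := by positivity
  set p := Real.arctan (1 / √2) with hp
  have hc : Real.cos p ≠ 0 := (Real.cos_arctan_pos _).ne'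
  have ht : Real.tan p = 1 / √2 := Real.tan_arctan _
  have hsin : Real.cos p = √2 * Real.sin p := by
    rw [Real.tan_eq_sin_div_cos] at ht
    field_simp at ht
    linarith
  set u := Real.sin p with hu
  have hu2 : u ^ 2 = 1 / 3 := by
    have := Real.sin_sq_add_cos_sq p
    rw [hsin] at this
    nlinarith
  have s2 : Real.sin (2 * p) = 2 * √2 / 3 := by
    rw [Real.sin_two_mul, hsin]; linear_combination 2 * √2 * hu2
  have c2 : Real.cos (2 * p) = 1 / 3 := by
    rw [Real.cos_two_mul, hsin]; linear_combination 2 * √2 * √2 * hu2 + 2 / 3 * hs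
  have s4 : Real.sin (4 * p) = 4 * √2 / 9 := by
    rw [show 4 * p = 2 * (2 * p) by ring, Real.sin_two_mul, s2, c2]; ring
  have c4 : Real.cos (4 * p) = - 7 / 9 := by
    rw [show 4 * p = 2 * (2 * p) by ring, Real.cos_two_mul, c2]; norm_num
  have hu0 : u ≠ 0 := by
    intro h; rw [h] at hu2; norm_num at hu2
  have t5 : Real.tan (5 * p) = - √2 / 22 := by
    rw [Real.tan_eq_sin_div_cos, show 5 * p = 4 * p + p by ring, Real.sin_add, Real.cos_add,
      s4, c4, hsin]
    rw [show 4 * √2 / 9 * (√2 * u) + -7 / 9 * u = u / 9 by linear_combination 4 / 9 * u * hs,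
      show -7 / 9 * (√2 * u) - 4 * √2 / 9 * u = - (11 / 9 * √2 * u) by ring]
    field_simp
    linarith
  rw [t5]
  have h1 : √(2 / 3 : ℝ) ≤ 1 := Real.sqrt_le_one.2 (by norm_num)
  have h2 : √2 ≤ 2 := by nlinarith
  have h3 : -(1 / 11 : ℝ) ≤ √(2 / 3) * (-√2 / 22) := by
    have := mul_le_mul h1 h2 hs0.le zero_le_one
    linarith
  have h4 : Real.arctan (-(1/11)) ≤ Real.arctan (√(2 / 3) * (-√2 / 22)) :=
    Real.arctan_strictMono.monotone h3
  rw [Real.arctan_neg] at h4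
  have h5 : Real.arctan (1 / 11) ≤ 1 / 11 := by
    have h := Real.le_tan (Real.arctan_nonneg.2 (by norm_num : (0:ℝ) ≤ 1 / 11)) (Real.arctan_lt_pi_div_two _)
    rwa [Real.tan_arctan] at h
  have := Real.pi_gt_three
  linarith
/-- the linear part of the coordinate map -/
noncomputable def rbLin (a b c : EuclideanSpace ℝ (Fin 3)) : (ℝ × ℝ × ℝ) →ₗ[ℝ] EuclideanSpace ℝ (Fin 3) where
  toFun v := ((v.1 - v.2.1 - v.2.2) / 2) • a + v.2.1 • b + v.2.2 • c
  map_add' v w := by simp only [Prod.fst_add, Prod.snd_add]; module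
  map_smul' r v := by
    simp only [Prod.smul_fst, Prod.smul_snd, smul_eq_mul, RingHom.id_apply]; module

lemma rb_norm (a b c : EuclideanSpace ℝ (Fin 3)) (ha : ‖a‖ = 2) (hb : ‖b‖ = 2) (hc : ‖c‖ = 2)
    (hab : ‖a - b‖ = 2) (hbc : ‖b - c‖ = 2) (hac : ‖a - c‖ = 2) (α β γ : ℝ) :
    ‖α • a + β • b + γ • c‖ ^ 2 =
      4 * (α ^ 2 + β ^ 2 + γ ^ 2 + α * β + β * γ + α * γ) := by
  have e1 := norm_sub_sq_real a b
  have e2 := norm_sub_sq_real b c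
  have e3 := norm_sub_sq_real a c
  rw [ha, hb, hab] at e1
  rw [hb, hc, hbc] at e2
  rw [ha, hc, hac] at e3
  rw [norm_add_sq_real, norm_add_sq_real, inner_add_left]
  simp only [norm_smul, inner_smul_left, inner_smul_right, ha, hb, hc, mul_pow, Real.norm_eq_abs,
    sq_abs, conj_trivial]
  linear_combination α * β * e1 + β * γ * e2 + α * γ * e3

lemma rb_coords (t : Fin 4 → EuclideanSpace ℝ (Fin 3))
    (ht : ∀ i j : Fin 4, i ≠ j → ‖t i - t j‖ = 2) :
    ∃ (φ : ℝ × ℝ × ℝ → EuclideanSpace ℝ (Fin 3)) (k : ENNReal), k ≠ 0 ∧ k ≠ ⊤ ∧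
      (∀ S, MeasurableSet S → volume S = k * volume (φ ⁻¹' S)) ∧
      φ ⁻¹' (convexHull ℝ (Set.range t)) = rbT ∧
      (∀ x y z, dist (φ (x, y, z)) (t 0) ^ 2
        = (x + 1) ^ 2 + 3 * y ^ 2 + 3 * z ^ 2 + 2 * y * z) ∧
      (∀ x y z, dist (φ (x, y, z)) (t 1) ^ 2
        = (x - 1) ^ 2 + 3 * y ^ 2 + 3 * z ^ 2 + 2 * y * z) ∧
      (∀ x y z, dist (φ (x, y, z)) (t 2) ^ 2
        = x ^ 2 + 3 * (y - 1) ^ 2 + 3 * z ^ 2 + 2 * (y - 1) * z) ∧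
      (∀ x y z, dist (φ (x, y, z)) (t 3) ^ 2
        = x ^ 2 + 3 * y ^ 2 + 3 * (z - 1) ^ 2 + 2 * y * (z - 1)) := by
  set a := t 1 - t 0 with ha
  set b := t 2 - t 0 with hb
  set c := t 3 - t 0 with hc
  have hN := rb_norm a b c (ht _ _ (by decide)) (ht _ _ (by decide)) (ht _ _ (by decide))
    (by rw [ha, hb, sub_sub_sub_cancel_right]; exact ht _ _ (by decide))
    (by rw [hc, hb, sub_sub_sub_cancel_right]; exact ht _ _ (by decide))
    (by rw [ha, hc, sub_sub_sub_cancel_right]; exact ht _ _ (by decide))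
  have hLapp : ∀ v : ℝ × ℝ × ℝ, rbLin a b c v =
    ((v.1 - v.2.1 - v.2.2) / 2) • a + v.2.1 • b + v.2.2 • c := fun v => rfl
  have hinj : Function.Injective (rbLin a b c) := by
    rw [← LinearMap.ker_eq_bot, LinearMap.ker_eq_bot']
    rintro ⟨x, y, z⟩ hv
    have h := hN ((x - y - z) / 2) y z
    rw [hLapp] at hv
    simp only at hv
    rw [hv, norm_zero] at h
    have hx : x = 0 := by nlinarith [sq_nonneg x, sq_nonneg (y+z), sq_nonneg y, sq_nonneg z]
    have hy : y = 0 := by nlinarith [sq_nonneg x, sq_nonneg (y+z), sq_nonneg y, sq_nonneg z]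
    have hz : z = 0 := by nlinarith [sq_nonneg x, sq_nonneg (y+z), sq_nonneg y, sq_nonneg z]
    simp [hx, hy, hz]
  let L : (ℝ × ℝ × ℝ) ≃L[ℝ] EuclideanSpace ℝ (Fin 3) :=
    (LinearMap.linearEquivOfInjective (rbLin a b c) hinj (by simp)).toContinuousLinearEquiv
  have hL : ∀ v, L v = rbLin a b c v := fun v => rfl
  let m : EuclideanSpace ℝ (Fin 3) := t 0 + (1 / 2 : ℝ) • a
  have hφ : ∀ v : ℝ × ℝ × ℝ, m + L v =
      t 0 + (((1 + v.1 - v.2.1 - v.2.2) / 2) • a + v.2.1 • b + v.2.2 • c) := by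
    intro v
    rw [hL, hLapp]; simp only [m]; module
  have i1 : (volume : Measure (ℝ × ℝ)).IsAddHaarMeasure :=
    Measure.prod.instIsAddHaarMeasure volume volume
  have i2 : (volume : Measure (ℝ × ℝ × ℝ)).IsAddHaarMeasure :=
    Measure.prod.instIsAddHaarMeasure volume volume
  have i3 : (volume.map L.symm : Measure (ℝ × ℝ × ℝ)).IsAddHaarMeasure :=
    L.symm.isAddHaarMeasure_map volume
  refine ⟨fun v => m + L v,
    (Measure.addHaarScalarFactor (volume.map L.symm : Measure (ℝ × ℝ × ℝ)) volume : NNReal),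
    ?_, ENNReal.coe_ne_top, ?_, ?_, ?_, ?_, ?_, ?_⟩
  · simpa only [ne_eq, ENNReal.coe_eq_zero] using
      (Measure.addHaarScalarFactor_pos_of_isAddHaarMeasure _ _).ne'
  · intro S hS
    have h := Measure.isAddLeftInvariant_eq_smul (volume.map L.symm : Measure (ℝ × ℝ × ℝ)) volume
    have hm : MeasurableSet ((fun v => m + L v) ⁻¹' S) :=
      (by fun_prop : Continuous fun v => m + L v).measurable hS
    have h2 := congrArg (fun μ => μ ((fun v => m + L v) ⁻¹' S)) h
    rw [Measure.map_apply (by exact L.symm.continuous.measurable) hm] at h2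
    rw [Measure.smul_apply] at h2
    have h3 : L.symm ⁻¹' ((fun v => m + L v) ⁻¹' S) = (fun p => m + p) ⁻¹' S := by
      ext p; simp
    rw [h3, measure_preimage_add] at h2
    exact h2
  · have hLinj : Function.Injective (fun v => m + L v) := fun v w h => by
      simpa using h
    apply Set.Subset.antisymm
    · have key : convexHull ℝ (Set.range t) ⊆ (fun v => m + L v) '' rbT := by
        apply convexHull_min
        · rintro _ ⟨i, rfl⟩
          fin_cases i
          · refine ⟨(-1, 0, 0), by simp [rbT], ?_⟩
            simp only [hφ]; simp
          · refine ⟨(1, 0, 0), by simp [rbT], ?_⟩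
            simp only [hφ]; norm_num [ha]
          · refine ⟨(0, 1, 0), by simp [rbT], ?_⟩
            simp only [hφ]; norm_num [hb]; rfl
          · refine ⟨(0, 0, 1), by simp [rbT], ?_⟩
            simp only [hφ]; norm_num [hc]; rfl
        · have hconv : Convex ℝ rbT := by
            have : rbT = {v : ℝ × ℝ × ℝ | 0 ≤ v.2.1 ∧ 0 ≤ v.2.2 ∧ v.2.1 + v.2.2 + v.1 ≤ 1 ∧
                v.2.1 + v.2.2 - v.1 ≤ 1} := by
              ext ⟨x, y, z⟩
              simp only [rbT, Set.mem_ofPred_eq]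
              constructor
              · rintro ⟨h1, h2, h3, h4⟩
                have := le_abs_self x
                have := neg_abs_le x
                exact ⟨h2, h3, by linarith, by linarith⟩
              · rintro ⟨h1, h2, h3, h4⟩
                have : |x| ≤ 1 - y - z := abs_le.2 ⟨by linarith, by linarith⟩
                exact ⟨by linarith, h1, h2, by linarith⟩
            rw [this]
            rintro ⟨x, y, z⟩ ⟨h1, h2, h3, h4⟩ ⟨x', y', z'⟩ ⟨h1', h2', h3', h4'⟩ r s hr hs hrs
            simp only [Set.mem_ofPred_eq, Prod.smul_mk, Prod.mk_add_mk, smul_eq_mul] at *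
            refine ⟨by positivity, by positivity, ?_, ?_⟩
            · nlinarith [mul_le_mul_of_nonneg_left h3 hr, mul_le_mul_of_nonneg_left h3' hs]
            · nlinarith [mul_le_mul_of_nonneg_left h4 hr, mul_le_mul_of_nonneg_left h4' hs]
          have h1 := (hconv.linear_image (L : (ℝ × ℝ × ℝ) →ₗ[ℝ] _)).translate m
          rw [Set.image_image] at h1
          exact h1
      intro v hv
      obtain ⟨w, hw, hwv⟩ := key hv
      rwa [← hLinj hwv]
    · rintro ⟨x, y, z⟩ ⟨h1, h2, h3, h4⟩
      simp only at h1 h2 h3 h4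
      have := le_abs_self x
      have := neg_abs_le x
      apply mem_convexHull_of_exists_fintype
        ![(1 - x - y - z) / 2, (1 + x - y - z) / 2, y, z] t
      · intro i
        fin_cases i <;> simp <;> linarith
      · simp [Fin.sum_univ_four]; ring
      · simp
      · simp only [hφ]
        simp only [Fin.sum_univ_four]
        simp [ha, hb, hc]
        module
  · intro x y z
    simp only [hφ]
    rw [dist_eq_norm, add_sub_cancel_left, hN]; ring
  · intro x y z
    simp only [hφ]
    rw [dist_eq_norm, show t 0 + (((1 + x - y - z) / 2) • a + y • b + z • c) - t 1 =
      ((x - 1 - y - z) / 2) • a + y • b + z • c by rw [ha]; module, hN]; ring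
  · intro x y z
    simp only [hφ]
    rw [dist_eq_norm, show t 0 + (((1 + x - y - z) / 2) • a + y • b + z • c) - t 2 =
      ((1 + x - y - z) / 2) • a + (y - 1) • b + z • c by rw [hb]; module, hN]; ring
  · intro x y z
    simp only [hφ]
    rw [dist_eq_norm, show t 0 + (((1 + x - y - z) / 2) • a + y • b + z • c) - t 3 =
      ((1 + x - y - z) / 2) • a + y • b + (z - 1) • c by rw [hc]; module, hN]; ring

lemma rb_meas (t : Fin 4 → EuclideanSpace ℝ (Fin 3)) :
    MeasurableSet (convexHull ℝ (Set.range t)) :=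
  (Set.finite_range t).isCompact_convexHull ℝ |>.measurableSet

lemma rb_fin (t : Fin 4 → EuclideanSpace ℝ (Fin 3)) :
    volume (convexHull ℝ (Set.range t)) ≠ ⊤ :=
  ((Set.finite_range t).isCompact_convexHull ℝ).measure_lt_top.ne

lemma rb_k (k V : ENNReal) (h : V = k * ENNReal.ofReal (1 / 3)) : k = 3 * V := by
  rw [h, mul_comm k, ← mul_assoc, show (3 : ENNReal) = ENNReal.ofReal 3 by simp,
    ← ENNReal.ofReal_mul (by norm_num)]
  norm_num

lemma rb_A : ∃ K : ENNReal, ∀ (t : Fin 4 → EuclideanSpace ℝ (Fin 3)),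
    (∀ i j : Fin 4, i ≠ j → ‖t i - t j‖ = 2) →
    volume (convexHull ℝ (Set.range t) ∩ closedBall (t 0) 1) =
      3 * volume (convexHull ℝ (Set.range t)) * K := by
  refine ⟨volume (rbT ∩ {v | (v.1 + 1) ^ 2 + 3 * v.2.1 ^ 2 + 3 * v.2.2 ^ 2
    + 2 * v.2.1 * v.2.2 ≤ 1}), fun t ht => ?_⟩
  obtain ⟨φ, k, hk0, hk1, hV, hT, h0, h1, h2, h3⟩ := rb_coords t ht
  have hk := hV _ (rb_meas t)
  rw [hT, rbT_vol] at hk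
  rw [← rb_k _ _ hk, hV _ ((rb_meas t).inter isClosed_closedBall.measurableSet),
    Set.preimage_inter, hT]
  congr 3
  ext ⟨x, y, z⟩
  rw [Set.mem_preimage, mem_closedBall, Set.mem_ofPred_eq, ← h0,
    sq_le_one_iff₀ dist_nonneg]

lemma rb_A_all (t : Fin 4 → EuclideanSpace ℝ (Fin 3))
    (ht : ∀ i j : Fin 4, i ≠ j → ‖t i - t j‖ = 2) (i : Fin 4) :
    volume (convexHull ℝ (Set.range t) ∩ closedBall (t i) 1) =
      volume (convexHull ℝ (Set.range t) ∩ closedBall (t 0) 1) := by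
  obtain ⟨K, hK⟩ := rb_A
  have h := hK (t ∘ Equiv.swap 0 i) (fun a b hab => ht _ _ (by simpa using hab))
  rw [EquivLike.range_comp] at h
  rw [hK t ht, ← h]
  simp

lemma rb_L (lam : ℝ) (hlam0 : 0 < lam) (hlam1 : lam < 1 / 6)
    (t : Fin 4 → EuclideanSpace ℝ (Fin 3))
    (ht : ∀ i j : Fin 4, i ≠ j → ‖t i - t j‖ = 2) :
    ENNReal.ofReal ((3 * lam ^ 2 + 2 * lam ^ 3) / 3) * volume (convexHull ℝ (Set.range t)) ≤
    volume ((convexHull ℝ (Set.range t) ∩ closedBall (t 0) (1 + lam)) ∩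
      (convexHull ℝ (Set.range t) ∩ closedBall (t 1) (1 + lam))) := by
  obtain ⟨φ, k, hk0, hk1, hV, hT, h0, h1, h2, h3⟩ := rb_coords t ht
  have hk := hV _ (rb_meas t)
  rw [hT, rbT_vol] at hk
  have hm := (((rb_meas t).inter (isClosed_closedBall (x := t 0) (ε := 1 + lam)).measurableSet).inter
    ((rb_meas t).inter (isClosed_closedBall (x := t 1) (ε := 1 + lam)).measurableSet))
  rw [hV _ hm]
  have key : {v : ℝ × ℝ × ℝ | |v.1| ≤ lam ∧ 0 ≤ v.2.1 ∧ 0 ≤ v.2.2 ∧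
      v.2.1 + v.2.2 ≤ √(((1 + lam) ^ 2 - (1 + |v.1|) ^ 2) / 3)} ⊆
      φ ⁻¹' ((convexHull ℝ (Set.range t) ∩ closedBall (t 0) (1 + lam)) ∩
      (convexHull ℝ (Set.range t) ∩ closedBall (t 1) (1 + lam))) := by
    rintro ⟨x, y, z⟩ ⟨hx, hy, hz, hyz⟩
    simp only at hx hy hz hyz
    have hax := abs_nonneg x
    have hr : 0 ≤ ((1 + lam) ^ 2 - (1 + |x|) ^ 2) / 3 := by
      apply div_nonneg _ (by norm_num)
      nlinarith
    have hs := pow_le_pow_left₀ (by positivity) hyz 2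
    rw [Real.sq_sqrt hr] at hs
    have hq : 3 * y ^ 2 + 3 * z ^ 2 + 2 * y * z ≤ (1 + lam) ^ 2 - (1 + |x|) ^ 2 := by
      nlinarith [mul_nonneg hy hz]
    have hxa := abs_le.1 (le_refl |x|)
    have hsx : |x| ^ 2 = x ^ 2 := sq_abs x
    have hmT : φ (x, y, z) ∈ convexHull ℝ (Set.range t) := by
      rw [← Set.mem_preimage, hT]
      refine ⟨by simp only; linarith, hy, hz, ?_⟩
      simp only
      have : y + z ≤ 1 / 2 := by
        by_contra hcon
        push Not at hcon
        nlinarith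
      linarith
    have hm0 : φ (x, y, z) ∈ closedBall (t 0) (1 + lam) := by
      rw [mem_closedBall]
      refine (sq_le_sq₀ dist_nonneg (by linarith)).1 ?_
      rw [h0]
      nlinarith
    have hm1 : φ (x, y, z) ∈ closedBall (t 1) (1 + lam) := by
      rw [mem_closedBall]
      refine (sq_le_sq₀ dist_nonneg (by linarith)).1 ?_
      rw [h1]
      nlinarith
    exact ⟨⟨hmT, hm0⟩, hmT, hm1⟩
  refine le_trans ?_ (mul_le_mul_right (measure_mono key) k)
  rw [rbL_vol lam hlam0.le, hk, mul_comm, mul_assoc, ← ENNReal.ofReal_mul (by norm_num)]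
  apply le_of_eq
  congr 2
  ring

lemma rb_perm : ∀ i j : Fin 4, i ≠ j → ∃ σ : Equiv.Perm (Fin 4), σ 0 = i ∧ σ 1 = j := by
  decide

lemma rb_L_all (lam : ℝ) (hlam0 : 0 < lam) (hlam1 : lam < 1 / 6)
    (t : Fin 4 → EuclideanSpace ℝ (Fin 3))
    (ht : ∀ i j : Fin 4, i ≠ j → ‖t i - t j‖ = 2) (i j : Fin 4) (hij : i ≠ j) :
    (3 * lam ^ 2 + 2 * lam ^ 3) / 3 * volume.real (convexHull ℝ (Set.range t)) ≤
    volume.real ((convexHull ℝ (Set.range t) ∩ closedBall (t i) (1 + lam)) ∩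
      (convexHull ℝ (Set.range t) ∩ closedBall (t j) (1 + lam))) := by
  obtain ⟨σ, rfl, rfl⟩ := rb_perm i j hij
  have h := rb_L lam hlam0 hlam1 (t ∘ σ) (fun a b hab => ht _ _ (by simpa using hab))
  rw [EquivLike.range_comp] at h
  have h2 := ENNReal.toReal_mono (measure_ne_top_of_subset
    (fun p hp => hp.1.1) (rb_fin t)) h
  rw [ENNReal.toReal_mul, ENNReal.toReal_ofReal (by positivity)] at h2
  exact h2

lemma rb_O (lam : ℝ) (hlam0 : 0 < lam) (hlam1 : lam < 1 / 6)
    (t : Fin 4 → EuclideanSpace ℝ (Fin 3))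
    (ht : ∀ i j : Fin 4, i ≠ j → ‖t i - t j‖ = 2) :
    0 < volume ((convexHull ℝ (Set.range t) ∩ closedBall (t 0) (1 + lam)) \
      ⋃ i : Fin 4, (convexHull ℝ (Set.range t) ∩ closedBall (t i) 1)) := by
  obtain ⟨φ, k, hk0, hk1, hV, hT, h0, h1, h2, h3⟩ := rb_coords t ht
  have hm := ((rb_meas t).inter (isClosed_closedBall (x := t 0) (ε := 1 + lam)).measurableSet).diff
    (MeasurableSet.iUnion (fun i : Fin 4 =>
      (rb_meas t).inter (isClosed_closedBall (x := t i) (ε := 1)).measurableSet))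
  rw [hV _ hm]
  apply ENNReal.mul_pos hk0
  apply ne_of_gt
  let O : Set (ℝ × ℝ × ℝ) := {v | 0 < v.2.1 ∧ 0 < v.2.2 ∧ v.2.1 + v.2.2 < 1 - |v.1| ∧
    (v.1 + 1) ^ 2 + 3 * v.2.1 ^ 2 + 3 * v.2.2 ^ 2 + 2 * v.2.1 * v.2.2 < (1 + lam) ^ 2 ∧
    1 < (v.1 + 1) ^ 2 + 3 * v.2.1 ^ 2 + 3 * v.2.2 ^ 2 + 2 * v.2.1 * v.2.2 ∧
    1 < (v.1 - 1) ^ 2 + 3 * v.2.1 ^ 2 + 3 * v.2.2 ^ 2 + 2 * v.2.1 * v.2.2 ∧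
    1 < v.1 ^ 2 + 3 * (v.2.1 - 1) ^ 2 + 3 * v.2.2 ^ 2 + 2 * (v.2.1 - 1) * v.2.2 ∧
    1 < v.1 ^ 2 + 3 * v.2.1 ^ 2 + 3 * (v.2.2 - 1) ^ 2 + 2 * v.2.1 * (v.2.2 - 1)}
  have hO : IsOpen O := by
    simp only [O, Set.ofPred_and]
    repeat' apply IsOpen.inter
    all_goals exact isOpen_lt (by fun_prop) (by fun_prop)
  have hne : O.Nonempty := by
    refine ⟨(0, lam / 4, lam / 4), ?_⟩
    simp only [O, Set.mem_ofPred_eq, abs_zero]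
    refine ⟨by positivity, by positivity, by linarith, ?_, ?_, ?_, ?_, ?_⟩ <;> nlinarith
  have i1 : (volume : Measure (ℝ × ℝ)).IsAddHaarMeasure :=
    Measure.prod.instIsAddHaarMeasure volume volume
  have i2 : (volume : Measure (ℝ × ℝ × ℝ)).IsAddHaarMeasure :=
    Measure.prod.instIsAddHaarMeasure volume volume
  refine lt_of_lt_of_le (hO.measure_pos volume hne) (measure_mono ?_)
  rintro ⟨x, y, z⟩ ⟨hy, hz, hyz, g, g0, g1, g2, g3⟩
  simp only at hy hz hyz g g0 g1 g2 g3
  rw [← h0] at g0 g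
  rw [← h1] at g1
  rw [← h2] at g2
  rw [← h3] at g3
  rw [one_lt_sq_iff₀ dist_nonneg] at g0 g1 g2 g3
  refine ⟨⟨?_, ?_⟩, ?_⟩
  · rw [← Set.mem_preimage, hT]
    exact ⟨by simp only; linarith, hy.le, hz.le, hyz.le⟩
  · rw [mem_closedBall]
    exact (sq_le_sq₀ dist_nonneg (by linarith)).1 g.le
  · rw [Set.mem_iUnion]
    rintro ⟨i, hi, hi2⟩
    rw [mem_closedBall] at hi2
    fin_cases i
    · exact absurd hi2 (not_le.2 g0)
    · exact absurd hi2 (not_le.2 g1)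
    · exact absurd hi2 (not_le.2 g2)
    · exact absurd hi2 (not_le.2 g3)

lemma rb_scale (lam : ℝ) (hlam0 : 0 < lam) (T : Set (EuclideanSpace ℝ (Fin 3)))
    (hT : Convex ℝ T) (hfin : volume T ≠ ⊤) (p : EuclideanSpace ℝ (Fin 3)) (hp : p ∈ T) :
    volume.real (T ∩ closedBall p (1 + lam)) ≤
      (1 + lam) ^ 3 * volume.real (T ∩ closedBall p 1) := by
  have hl : 0 < 1 + lam := by linarith
  have key : T ∩ closedBall p (1 + lam) ⊆
      AffineMap.homothety p (1 + lam) '' (T ∩ closedBall p 1) := by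
    rintro q ⟨hq, hq2⟩
    refine ⟨AffineMap.homothety p (1 + lam)⁻¹ q, ⟨?_, ?_⟩, ?_⟩
    · rw [AffineMap.homothety_eq_lineMap]
      exact hT.lineMap_mem hp hq ⟨by positivity, inv_le_one_of_one_le₀ (by linarith)⟩
    · rw [mem_closedBall, dist_homothety_center, Real.norm_eq_abs, abs_of_pos (by positivity)]
      rw [mem_closedBall, dist_comm] at hq2
      rw [inv_mul_le_iff₀ hl]
      linarith
    · rw [← AffineMap.homothety_mul_apply, mul_inv_cancel₀ hl.ne']
      simp
  have h := measure_mono (μ := volume) key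
  rw [Measure.addHaar_image_homothety] at h
  have h2 := ENNReal.toReal_mono (ENNReal.mul_ne_top ENNReal.ofReal_ne_top
    (measure_ne_top_of_subset Set.inter_subset_left hfin)) h
  rw [ENNReal.toReal_mul, ENNReal.toReal_ofReal (by positivity), abs_of_pos (by positivity)] at h2
  simpa [Measure.real] using h2

lemma rb_incl {α : Type*} [MeasurableSpace α] (μ : Measure α) (T : Set α) (hT : μ T ≠ ⊤)
    (S : Fin 4 → Set α) (hS : ∀ i, MeasurableSet (S i)) (hST : ∀ i, S i ⊆ T)
    (h3 : ∀ i j k, i ≠ j → j ≠ k → i ≠ k → ∀ x, x ∈ S i → x ∈ S j → x ∈ S k → False) :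
    μ.real (⋃ i, S i) + (μ.real (S 0 ∩ S 1) + μ.real (S 0 ∩ S 2) + μ.real (S 0 ∩ S 3)
      + μ.real (S 1 ∩ S 2) + μ.real (S 1 ∩ S 3) + μ.real (S 2 ∩ S 3))
      = μ.real (S 0) + μ.real (S 1) + μ.real (S 2) + μ.real (S 3) := by
  have hf : ∀ A : Set α, A ⊆ T → μ A ≠ ⊤ := fun A hA => measure_ne_top_of_subset hA hT
  have hU : (⋃ i, S i) = ((S 0 ∪ S 1) ∪ S 2) ∪ S 3 := by
    ext x
    simp only [Set.mem_iUnion, Set.mem_union, Fin.exists_fin_succ, Fin.exists_fin_zero]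
    simp [or_assoc]
  have f01 : S 0 ∪ S 1 ⊆ T := Set.union_subset (hST _) (hST _)
  have f012 : S 0 ∪ S 1 ∪ S 2 ⊆ T := Set.union_subset f01 (hST _)
  have e1 := measureReal_union_add_inter (μ := μ) (s := S 0) (t := S 1) (hS 1)
    (hf _ (hST 0)) (hf _ (hST 1))
  have e2 := measureReal_union_add_inter (μ := μ) (s := S 0 ∪ S 1) (t := S 2) (hS 2)
    (hf _ f01) (hf _ (hST 2))
  have e3 := measureReal_union_add_inter (μ := μ) (s := S 0 ∪ S 1 ∪ S 2) (t := S 3) (hS 3)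
    (hf _ f012) (hf _ (hST 3))
  rw [Set.union_inter_distrib_right, measureReal_union _ ((hS 1).inter (hS 2))
    (hf _ (Set.inter_subset_left.trans (hST _))) (hf _ (Set.inter_subset_left.trans (hST _)))] at e2
  rw [Set.union_inter_distrib_right, Set.union_inter_distrib_right,
    measureReal_union _ ((hS 2).inter (hS 3))
    (hf _ (Set.union_subset (Set.inter_subset_left.trans (hST _))
      (Set.inter_subset_left.trans (hST _)))) (hf _ (Set.inter_subset_left.trans (hST _))),
    measureReal_union _ ((hS 1).inter (hS 3))
    (hf _ (Set.inter_subset_left.trans (hST _))) (hf _ (Set.inter_subset_left.trans (hST _)))] at e3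
  · rw [hU]; linarith
  · rw [Set.disjoint_left]
    rintro x ⟨a, b⟩ ⟨c, d⟩
    exact h3 0 1 3 (by decide) (by decide) (by decide) x a c b
  · rw [Set.disjoint_left]
    rintro x (⟨a, b⟩ | ⟨a, b⟩) ⟨c, d⟩
    · exact h3 0 2 3 (by decide) (by decide) (by decide) x a c b
    · exact h3 1 2 3 (by decide) (by decide) (by decide) x a c b
  · rw [Set.disjoint_left]
    rintro x ⟨a, b⟩ ⟨c, d⟩
    exact h3 0 1 2 (by decide) (by decide) (by decide) x a c b

lemma rb_triple (r : ℝ) (hr : r ^ 2 < 4 / 3) (a b c x : EuclideanSpace ℝ (Fin 3))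
    (hab : ‖a - b‖ = 2) (hbc : ‖b - c‖ = 2) (hac : ‖a - c‖ = 2)
    (ha : x ∈ closedBall a r) (hb : x ∈ closedBall b r) (hc : x ∈ closedBall c r) : False := by
  rw [mem_closedBall, dist_eq_norm] at ha hb hc
  have ha2 := pow_le_pow_left₀ (norm_nonneg _) ha 2
  have hb2 := pow_le_pow_left₀ (norm_nonneg _) hb 2
  have hc2 := pow_le_pow_left₀ (norm_nonneg _) hc 2
  set u := x - a
  set v := x - b
  set w := x - c
  have e1 : ‖v - u‖ ^ 2 = 4 := by
    rw [show v - u = a - b by simp only [u, v]; abel, hab]; norm_num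
  have e2 : ‖w - v‖ ^ 2 = 4 := by
    rw [show w - v = b - c by simp only [w, v]; abel, hbc]; norm_num
  have e3 : ‖w - u‖ ^ 2 = 4 := by
    rw [show w - u = a - c by simp only [u, w]; abel, hac]; norm_num
  have e4 : 0 ≤ ‖u + v + w‖ ^ 2 := by positivity
  rw [norm_sub_sq_real] at e1 e2 e3
  rw [norm_add_sq_real, norm_add_sq_real, inner_add_left] at e4
  have := real_inner_comm u v
  have := real_inner_comm u w
  have := real_inner_comm v w
  linarith

lemma rb_disj (a b : EuclideanSpace ℝ (Fin 3)) (hab : ‖a - b‖ = 2) :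
    volume (closedBall a 1 ∩ closedBall b 1) = 0 := by
  refine measure_mono_null (t := {(1 / 2 : ℝ) • (a + b)}) ?_ (measure_singleton _)
  rintro x ⟨ha, hb⟩
  rw [mem_closedBall, dist_eq_norm] at ha hb
  have ha2 := pow_le_pow_left₀ (norm_nonneg _) ha 2
  have hb2 := pow_le_pow_left₀ (norm_nonneg _) hb 2
  have hp := parallelogram_law_with_norm ℝ (x - a) (x - b)
  rw [show x - a - (x - b) = -(a - b) by abel, norm_neg, hab] at hp
  have h0 : ‖x - a + (x - b)‖ = 0 := by
    have := norm_nonneg (x - a + (x - b))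
    nlinarith
  rw [norm_eq_zero] at h0
  rw [Set.mem_singleton_iff, ← sub_eq_zero]
  calc x - (1 / 2 : ℝ) • (a + b) = (1 / 2 : ℝ) • (x - a + (x - b)) := by module
    _ = 0 := by rw [h0, smul_zero]

theorem rb_main (lam : ℝ) (hlam0 : 0 < lam)
    (hlam1 : lam < 2 / Real.sqrt 3 - 1)
    (t : Fin 4 → EuclideanSpace ℝ (Fin 3))
    (ht : ∀ i j : Fin 4, i ≠ j → ‖t i - t j‖ = 2) (a A V : ℝ) (ha : Real.pi < 2 * a)
    (hA : A = volume.real (convexHull ℝ (Set.range t) ∩ closedBall (t 0) 1))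
    (hV : V = volume.real (convexHull ℝ (Set.range t) ∩ ⋃ i : Fin 4, closedBall (t i) (1 + lam))) :
    a / (a * (1 + lam) ^ 3 - Real.pi * (3 * lam ^ 2 + 2 * lam ^ 3)) < 4 * A / V ∧
      4 * A / V < 1 := by
  have h43 : (1 + lam) ^ 2 < 4 / 3 := by
    have h1 : 1 + lam < 2 / √3 := by linarith
    have h2 := pow_lt_pow_left₀ h1 (by linarith) two_ne_zero
    rw [div_pow, Real.sq_sqrt (by norm_num)] at h2
    linarith
  have hl6 : lam < 1 / 6 := by nlinarith
  set T := convexHull ℝ (Set.range t) with hTdef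
  have hTm : MeasurableSet T := rb_meas t
  have hTf : volume T ≠ ⊤ := rb_fin t
  have hsub : ∀ i, volume.real (T ∩ closedBall (t i) (1 + lam)) ≤ (1 + lam) ^ 3 * A := by
    intro i
    have h := rb_scale lam hlam0 T (convex_convexHull ℝ _) hTf (t i)
      (subset_convexHull ℝ _ ⟨i, rfl⟩)
    have h2 : volume.real (T ∩ closedBall (t i) 1) = A := by
      rw [hA]; exact congrArg ENNReal.toReal (rb_A_all t ht i)
    rwa [h2] at h
  have hinc := rb_incl volume T hTf (fun i => T ∩ closedBall (t i) (1 + lam))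
    (fun i => hTm.inter isClosed_closedBall.measurableSet) (fun i => Set.inter_subset_left)
    (fun i j k hij hjk hik x hi hj hk => rb_triple (1 + lam) h43 (t i) (t j) (t k) x
      (ht _ _ hij) (ht _ _ hjk) (ht _ _ hik) hi.2 hj.2 hk.2)
  rw [← Set.inter_iUnion, ← hV] at hinc
  have hL := rb_L_all lam hlam0 hl6 t ht
  have L1 := hL 0 1 (by decide)
  have L2 := hL 0 2 (by decide)
  have L3 := hL 0 3 (by decide)
  have L4 := hL 1 2 (by decide)
  have L5 := hL 1 3 (by decide)
  have L6 := hL 2 3 (by decide)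
  rw [← hTdef] at L1 L2 L3 L4 L5 L6
  -- the four unit caps
  have hUn : volume.real (⋃ i, (T ∩ closedBall (t i) 1)) = 4 * A := by
    have h := measure_iUnion₀ (μ := volume) (f := fun i : Fin 4 => T ∩ closedBall (t i) 1)
      (fun i j hij => measure_mono_null (Set.inter_subset_inter Set.inter_subset_right
        Set.inter_subset_right) (rb_disj _ _ (ht i j hij)))
      (fun i => (hTm.inter isClosed_closedBall.measurableSet).nullMeasurableSet)
    simp only [hTdef, rb_A_all t ht] at h
    rw [tsum_fintype, Finset.sum_const, Finset.card_univ, Fintype.card_fin] at h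
    have h' := congrArg ENNReal.toReal h
    rw [nsmul_eq_mul, ENNReal.toReal_mul] at h'
    rw [hA]
    simpa [Measure.real, hTdef] using h'
  have hUT : 4 * A ≤ volume.real T := by
    rw [← hUn]
    exact measureReal_mono (Set.iUnion_subset fun i => Set.inter_subset_left) hTf
  have hlt : 4 * A < V := by
    have hO := rb_O lam hlam0 hl6 t ht
    rw [← hTdef] at hO
    have hOf := measure_ne_top_of_subset
      ((Set.diff_subset (s := T ∩ closedBall (t 0) (1 + lam))
        (t := ⋃ i : Fin 4, (T ∩ closedBall (t i) 1))).trans Set.inter_subset_left) hTf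
    have hOr := ENNReal.toReal_pos hO.ne' hOf
    have hdis := measureReal_union (μ := volume) (s₁ := ⋃ i : Fin 4, (T ∩ closedBall (t i) 1))
      (s₂ := (T ∩ closedBall (t 0) (1 + lam)) \ ⋃ i : Fin 4, (T ∩ closedBall (t i) 1))
      Set.disjoint_sdiff_right
      ((hTm.inter isClosed_closedBall.measurableSet).diff
        (MeasurableSet.iUnion fun i => hTm.inter isClosed_closedBall.measurableSet))
      (measure_ne_top_of_subset (Set.iUnion_subset fun i => Set.inter_subset_left) hTf) hOf
    have hle : volume.real ((⋃ i : Fin 4, (T ∩ closedBall (t i) 1)) ∪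
        ((T ∩ closedBall (t 0) (1 + lam)) \ ⋃ i : Fin 4, (T ∩ closedBall (t i) 1))) ≤ V := by
      rw [hV]
      refine measureReal_mono ?_ (measure_ne_top_of_subset Set.inter_subset_left hTf)
      rw [Set.inter_iUnion]
      apply Set.union_subset
      · exact Set.iUnion_mono fun i => Set.inter_subset_inter_right _
          (closedBall_subset_closedBall (by linarith))
      · exact Set.diff_subset.trans
          (Set.subset_iUnion (fun i => T ∩ closedBall (t i) (1 + lam)) 0)
    have hOr' : 0 < volume.real
      ((T ∩ closedBall (t 0) (1 + lam)) \ ⋃ i : Fin 4, (T ∩ closedBall (t i) 1)) := hOr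
    linarith
  have hA0 : 0 ≤ A := by rw [hA]; exact measureReal_nonneg
  have hV0 : 0 < V := by linarith
  have hP : 0 < 3 * lam ^ 2 + 2 * lam ^ 3 := by positivity
  set P := 3 * lam ^ 2 + 2 * lam ^ 3 with hPdef
  have hVle : V + 2 * P * (4 * A) ≤ 4 * ((1 + lam) ^ 3 * A) := by
    have s0 := hsub 0
    have s1 := hsub 1
    have s2 := hsub 2
    have s3 := hsub 3
    have := mul_le_mul_of_nonneg_left hUT hP.le
    linarith
  have hApos : 0 < A := by
    rcases hA0.lt_or_eq with h | h
    · exact h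
    · rw [← h] at hVle; linarith
  have hpi := Real.pi_pos
  have ha0 : 0 < a := by linarith
  have hD : a * V < 4 * A * (a * (1 + lam) ^ 3 - Real.pi * P) := by
    have h1 := mul_le_mul_of_nonneg_left hVle ha0.le
    have h2 := mul_lt_mul_of_pos_right ha (by positivity : 0 < P * (4 * A))
    linarith
  have hDpos : 0 < a * (1 + lam) ^ 3 - Real.pi * P := by
    have h1 : 0 < a * V := by positivity
    exact pos_of_mul_pos_right (h1.trans hD) (by positivity)
  constructor
  · rw [div_lt_div_iff₀ hDpos hV0]
    exact hD
  · rw [div_lt_one hV0]; exact hlt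

/-- For `0 < λ < 2/√3 - 1`, `ℓ = 1 + λ`, `φ₀ = arctan(1/√2)`, `ψ₀ = -arctan(√(2/3)·tan(5φ₀))`,
and a regular `3`-simplex `T³ = conv{t 1, …, t 4}` of edge length `2` in `E³`, setting
`σ₃(λ) = 4·vol₃(T³ ∩ (t 1 + B³)) / vol₃(T³ ∩ ⋃ (t i + ℓB³))`, one has
`(π - 6ψ₀)/(π - 6ψ₀ + (3π - 18ψ₀)λ - 18ψ₀λ² - (π + 6ψ₀)λ³) < σ₃(λ)` and `σ₃(λ) < 1`. -/
theorem rogers_bound_lt_simplex_bound (lam : ℝ) (hlam0 : 0 < lam)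
    (hlam1 : lam < 2 / Real.sqrt 3 - 1)
    (t : Fin 4 → EuclideanSpace ℝ (Fin 3))
    (ht : ∀ i j : Fin 4, i ≠ j → ‖t i - t j‖ = 2) :
    (Real.pi - 6 * (-Real.arctan (Real.sqrt (2 / 3) *
        Real.tan (5 * Real.arctan (1 / Real.sqrt 2))))) /
      (Real.pi - 6 * (-Real.arctan (Real.sqrt (2 / 3) *
          Real.tan (5 * Real.arctan (1 / Real.sqrt 2)))) +
        (3 * Real.pi - 18 * (-Real.arctan (Real.sqrt (2 / 3) *
          Real.tan (5 * Real.arctan (1 / Real.sqrt 2))))) * lam -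
        18 * (-Real.arctan (Real.sqrt (2 / 3) *
          Real.tan (5 * Real.arctan (1 / Real.sqrt 2)))) * lam ^ 2 -
        (Real.pi + 6 * (-Real.arctan (Real.sqrt (2 / 3) *
          Real.tan (5 * Real.arctan (1 / Real.sqrt 2))))) * lam ^ 3) <
      4 * (volume (convexHull ℝ (Set.range t) ∩ closedBall (t 0) 1)).toReal /
        (volume (convexHull ℝ (Set.range t) ∩
          ⋃ i : Fin 4, closedBall (t i) (1 + lam))).toReal ∧
    4 * (volume (convexHull ℝ (Set.range t) ∩ closedBall (t 0) 1)).toReal /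
        (volume (convexHull ℝ (Set.range t) ∩
          ⋃ i : Fin 4, closedBall (t i) (1 + lam))).toReal < 1 := by
  have h := rb_main lam hlam0 hlam1 t ht _ _ _ rb_num rfl rfl
  refine ⟨lt_of_eq_of_lt ?_ h.1, h.2⟩
  congr 1
  ring
end

section
/- Let d ≥ 2, let 0 ≤ λ < √(2d/(d+1)) − 1, and set ℓ = 1 + λ. Let T^d = conv{t_1, …, t_{d+1}} be a regular d-simplex of edge length 2 in E^d and set σ̄_d(λ) = vol_d(T^d ∩ ⋃_{i=1}^{d+1} (t_i + ℓB^d)) / vol_d(T^d). Then for every infinite packing of unit balls in E^d with centers c_1, c_2, …, one has limsup_{R→∞} vol_d((⋃_i (c_i + ℓB^d)) ∩ RB^d) / vol_d(RB^d) ≤ σ̄_d(λ), and moreover σ̄_d(λ) < 1. -/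
open MeasureTheory Metric

namespace SoftBall

abbrev E (d : ℕ) := EuclideanSpace ℝ (Fin d)

variable {d : ℕ}

/-- The cell of the origin with respect to the finite set `N`. -/
def cell (N : Finset (E d)) : Set (E d) := {x | ∀ a ∈ N, inner ℝ a x ≤ ‖a‖ ^ 2 / 2}

def face (N : Finset (E d)) (L : Set (E d)) : Set (E d) :=
  {x | x ∈ cell N ∧ ∀ a ∈ L, inner ℝ a x = ‖a‖ ^ 2 / 2}

open Classical in
noncomputable def near (K : Set (E d)) : E d :=
  if h : ∃ v ∈ K, ∀ x ∈ K, ‖v‖ ^ 2 ≤ inner ℝ v x then h.choose else 0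

lemma near_spec {K : Set (E d)} (hc : IsClosed K) (hv : Convex ℝ K) (hne : K.Nonempty) :
    near K ∈ K ∧ ∀ x ∈ K, ‖near K‖ ^ 2 ≤ inner ℝ (near K) x := by
  have h : ∃ v ∈ K, ∀ x ∈ K, ‖v‖ ^ 2 ≤ inner ℝ v x := by
    obtain ⟨v, hvK, hv'⟩ := exists_norm_eq_iInf_of_complete_convex hne hc.isComplete hv 0
    refine ⟨v, hvK, fun x hx => ?_⟩
    have := (norm_eq_iInf_iff_real_inner_le_zero hv hvK).1 hv' x hx
    simp only [zero_sub, inner_neg_left, inner_sub_right, real_inner_self_eq_norm_sq] at this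
    linarith
  unfold near
  rw [dif_pos h]
  exact h.choose_spec

lemma near_unique {K : Set (E d)} {v w : E d} (hv : v ∈ K) (hw : w ∈ K)
    (h1 : ∀ x ∈ K, ‖v‖ ^ 2 ≤ inner ℝ v x) (h2 : ∀ x ∈ K, ‖w‖ ^ 2 ≤ inner ℝ w x) : v = w := by
  have a := h1 w hw
  have b := h2 v hv
  rw [real_inner_comm] at b
  have : ‖v - w‖ ^ 2 ≤ 0 := by rw [norm_sub_sq_real]; linarith
  have : ‖v - w‖ = 0 := by nlinarith [norm_nonneg (v - w)]
  exact sub_eq_zero.1 (norm_eq_zero.1 this)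

lemma isClosed_cell (N : Finset (E d)) : IsClosed (cell N) := by
  have : cell N = ⋂ a ∈ N, {x | inner ℝ a x ≤ ‖a‖ ^ 2 / 2} := by ext; simp [cell]
  rw [this]
  exact isClosed_biInter fun a _ => isClosed_le (by fun_prop) (by fun_prop)

lemma isClosed_face (N : Finset (E d)) (L : Set (E d)) : IsClosed (face N L) := by
  have : face N L = cell N ∩ ⋂ a ∈ L, {x | inner ℝ a x = ‖a‖ ^ 2 / 2} := by ext; simp [face]
  rw [this]
  exact (isClosed_cell N).inter
    (isClosed_biInter fun a _ => isClosed_eq (by fun_prop) (by fun_prop))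

lemma convex_cell (N : Finset (E d)) : Convex ℝ (cell N) := by
  intro x hx y hy p q hp hq hpq a ha
  have h1 := hx a ha
  have h2 := hy a ha
  rw [inner_add_right, inner_smul_right, inner_smul_right]
  have : ‖a‖ ^ 2 / 2 = p * (‖a‖ ^ 2 / 2) + q * (‖a‖ ^ 2 / 2) := by rw [← add_mul, hpq, one_mul]
  rw [this]
  gcongr

lemma convex_face (N : Finset (E d)) (L : Set (E d)) : Convex ℝ (face N L) := by
  intro x hx y hy p q hp hq hpq
  refine ⟨convex_cell N hx.1 hy.1 hp hq hpq, fun a ha => ?_⟩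
  rw [inner_add_right, inner_smul_right, inner_smul_right, hx.2 a ha, hy.2 a ha, ← add_mul, hpq,
    one_mul]

lemma zero_mem_cell (N : Finset (E d)) : (0 : E d) ∈ cell N := by
  intro a _
  simp only [inner_zero_right]
  positivity

lemma face_anti (N : Finset (E d)) {L L' : Set (E d)} (h : L ⊆ L') : face N L' ⊆ face N L :=
  fun _ hx => ⟨hx.1, fun a ha => hx.2 a (h ha)⟩

def pre (s : ℕ → E d) (k : ℕ) : Set (E d) := s '' Set.Iio k

noncomputable def vert (N : Finset (E d)) (s : ℕ → E d) (k : ℕ) : E d := near (face N (pre s k))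

lemma pre_mono (s : ℕ → E d) {i j : ℕ} (h : i ≤ j) : pre s i ⊆ pre s j :=
  Set.image_mono (Set.Iio_subset_Iio h)

lemma pre_congr {s s' : ℕ → E d} {k : ℕ} (h : ∀ i < k, s' i = s i) : pre s' k = pre s k :=
  Set.image_congr (fun i hi => h i hi)

lemma face_succ (N : Finset (E d)) (s : ℕ → E d) (k : ℕ) :
    face N (pre s (k + 1)) = {x | x ∈ face N (pre s k) ∧ inner ℝ (s k) x = ‖s k‖ ^ 2 / 2} := by
  ext x
  simp only [face, pre, Set.mem_ofPred_eq, Set.forall_mem_image, Set.mem_Iio]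
  constructor
  · rintro ⟨h1, h2⟩
    exact ⟨⟨h1, fun i hi => h2 (by omega)⟩, h2 (by omega)⟩
  · rintro ⟨⟨h1, h2⟩, h3⟩
    refine ⟨h1, fun i hi => ?_⟩
    rcases Nat.lt_succ_iff_lt_or_eq.1 hi with h | rfl
    · exact h2 h
    · exact h3

structure IsFlag (N : Finset (E d)) (s : ℕ → E d) : Prop where
  mem : ∀ i < d, s i ∈ N
  li : LinearIndependent ℝ (fun i : Fin d => s i)
  ne : (face N (pre s d)).Nonempty

lemma vert_spec {N : Finset (E d)} {s : ℕ → E d} {k : ℕ} (h : (face N (pre s k)).Nonempty) :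
    vert N s k ∈ face N (pre s k) ∧
      ∀ x ∈ face N (pre s k), ‖vert N s k‖ ^ 2 ≤ inner ℝ (vert N s k) x :=
  near_spec (isClosed_face _ _) (convex_face _ _) h

lemma vert_zero (N : Finset (E d)) (s : ℕ → E d) : vert N s 0 = 0 := by
  have h0 : (0 : E d) ∈ face N (pre s 0) := ⟨zero_mem_cell N, by simp [pre]⟩
  have := (vert_spec ⟨_, h0⟩).2 0 h0
  simp only [inner_zero_right] at this
  have : ‖vert N s 0‖ = 0 := by nlinarith [norm_nonneg (vert N s 0)]
  exact norm_eq_zero.1 this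

lemma IsFlag.face_ne {N : Finset (E d)} {s : ℕ → E d} (h : IsFlag N s) {k : ℕ} (hk : k ≤ d) :
    (face N (pre s k)).Nonempty := h.ne.mono (face_anti N (pre_mono s hk))

lemma IsFlag.vert_mem {N : Finset (E d)} {s : ℕ → E d} (h : IsFlag N s) {k j : ℕ} (hkj : k ≤ j)
    (hj : j ≤ d) : vert N s j ∈ face N (pre s k) :=
  face_anti N (pre_mono s hkj) (vert_spec (h.face_ne hj)).1

/-! ### Covering -/

lemma exists_exit {N : Finset (E d)} (hb : ∃ M, ∀ x ∈ cell N, ‖x‖ ≤ M) {s : ℕ → E d} {k : ℕ}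
    {v x w : E d} (hv : v ∈ face N (pre s k)) (hx : x ∈ face N (pre s k)) (hw : w ≠ 0)
    (hwo : ∀ i < k, inner ℝ (s i) w = 0) {r : ℝ} (hr : 0 ≤ r) (hxr : x = v + r • w) :
    ∃ y ∈ face N (pre s k), ∃ a ∈ N, inner ℝ a y = ‖a‖ ^ 2 / 2 ∧ inner ℝ a w ≠ 0 ∧
      x ∈ segment ℝ v y := by
  classical
  set Q := N.filter (fun a => 0 < inner ℝ a w) with hQ
  have hne : Q.Nonempty := by
    by_contra hcon
    rw [Finset.not_nonempty_iff_eq_empty, Finset.filter_eq_empty_iff] at hcon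
    obtain ⟨M, hM⟩ := hb
    have hw' : 0 < ‖w‖ := norm_pos_iff.2 hw
    have h1 : ∀ t : ℝ, 0 ≤ t → v + t • w ∈ cell N := by
      intro t ht a ha
      have h2 := hcon ha
      have h3 := hv.1 a ha
      rw [inner_add_right, inner_smul_right]
      nlinarith
    have h0M : 0 ≤ M := (norm_nonneg _).trans (hM v hv.1)
    have h4 := hM _ (h1 ((M + ‖v‖ + 1) / ‖w‖) (by positivity))
    have h5 : ‖((M + ‖v‖ + 1) / ‖w‖) • w‖ ≤ ‖v + ((M + ‖v‖ + 1) / ‖w‖) • w‖ + ‖v‖ := by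
      have := norm_sub_le (v + ((M + ‖v‖ + 1) / ‖w‖) • w) v
      rwa [add_sub_cancel_left] at this
    rw [norm_smul, Real.norm_of_nonneg (by positivity), div_mul_cancel₀ _ hw'.ne'] at h5
    linarith
  obtain ⟨a, haQ, hmin⟩ := Q.exists_min_image (fun a => (‖a‖ ^ 2 / 2 - inner ℝ a v) / inner ℝ a w) hne
  obtain ⟨haN, haw⟩ := Finset.mem_filter.1 haQ
  set T := (‖a‖ ^ 2 / 2 - inner ℝ a v) / inner ℝ a w with hT
  have hT0 : 0 ≤ T := div_nonneg (by linarith [hv.1 a haN]) haw.le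
  have hrT : r ≤ T := by
    rw [hT, le_div_iff₀ haw]
    have := hx.1 a haN
    rw [hxr, inner_add_right, inner_smul_right] at this
    linarith
  refine ⟨v + T • w, ⟨?_, ?_⟩, a, haN, ?_, haw.ne', ?_⟩
  · intro a' ha'
    rw [inner_add_right, inner_smul_right]
    by_cases h : 0 < inner ℝ a' w
    · have := hmin a' (Finset.mem_filter.2 ⟨ha', h⟩)
      rw [le_div_iff₀ h] at this
      linarith
    · have := hv.1 a' ha'
      nlinarith
  · rintro _ ⟨i, hi, rfl⟩
    rw [inner_add_right, inner_smul_right, hwo i hi, mul_zero, add_zero]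
    exact hv.2 _ ⟨i, hi, rfl⟩
  · rw [inner_add_right, inner_smul_right, hT, div_mul_cancel₀ _ haw.ne']
    ring
  · rw [segment_eq_image']
    rcases hT0.eq_or_lt with h | h
    · have : r = 0 := by linarith
      exact ⟨0, by simp, by simp [hxr, this]⟩
    · refine ⟨r / T, ⟨by positivity, by rw [div_le_one h]; exact hrT⟩, ?_⟩
      simp only [add_sub_cancel_left, smul_smul]
      rw [div_mul_cancel₀ _ h.ne', hxr]

lemma exists_dir {s : ℕ → E d} {k : ℕ} (hk : k < d) :
    ∃ w : E d, w ≠ 0 ∧ ∀ i < k, inner ℝ (s i) w = 0 := by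
  classical
  set W := Submodule.span ℝ (Set.range (fun i : Fin k => s i)) with hW
  have h1 : Module.finrank ℝ W ≤ k := by
    have := finrank_range_le_card (R := ℝ) (fun i : Fin k => s i)
    simpa [Set.finrank] using this
  have h2 := Submodule.finrank_add_finrank_orthogonal W
  rw [finrank_euclideanSpace_fin] at h2
  have h3 : Wᗮ ≠ ⊥ := by
    intro h
    rw [h, finrank_bot] at h2
    omega
  obtain ⟨w, hw, hw0⟩ := Submodule.exists_mem_ne_zero_of_ne_bot h3
  refine ⟨w, hw0, fun i hi => ?_⟩
  exact (Submodule.mem_orthogonal W w).1 hw _ (Submodule.subset_span ⟨⟨i, hi⟩, rfl⟩)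

lemma inner_span_zero {S : Set (E d)} {w a : E d} (h : ∀ u ∈ S, inner ℝ u w = 0)
    (ha : a ∈ Submodule.span ℝ S) : inner ℝ a w = 0 := by
  induction ha using Submodule.span_induction with
  | mem x hx => exact h x hx
  | zero => simp
  | add x y _ _ hx hy => rw [inner_add_left, hx, hy, add_zero]
  | smul a x _ hx => rw [inner_smul_left, hx, mul_zero]

lemma eq_of_full {s : ℕ → E d} (hli : LinearIndependent ℝ (fun i : Fin d => s i)) {z : E d}
    (hz : ∀ i < d, inner ℝ (s i) z = 0) : z = 0 := by
  have hspan := hli.span_eq_top_of_card_eq_finrank' (by simp)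
  have hz' : z ∈ (Submodule.span ℝ (Set.range (fun i : Fin d => s i)))ᗮ := by
    rw [Submodule.mem_orthogonal]
    intro u hu
    refine inner_span_zero ?_ hu
    rintro _ ⟨i, rfl⟩
    exact hz i i.2
  rw [hspan, Submodule.top_orthogonal_eq_bot] at hz'
  simpa using hz'

lemma cover_aux {N : Finset (E d)} (hb : ∃ M, ∀ x ∈ cell N, ‖x‖ ≤ M) (m : ℕ) :
    ∀ k, k + m = d → ∀ (s : ℕ → E d) (x : E d), (∀ i < k, s i ∈ N) →
      LinearIndependent ℝ (fun i : Fin k => s i) → x ∈ face N (pre s k) →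
      ∃ s' : ℕ → E d, IsFlag N s' ∧ (∀ i < k, s' i = s i) ∧
        x ∈ convexHull ℝ (vert N s' '' Set.Icc k d) := by
  induction m with
  | zero =>
    intro k hk s x hs hli hx
    obtain rfl : k = d := by omega
    refine ⟨s, ⟨hs, hli, ⟨x, hx⟩⟩, fun _ _ => rfl, ?_⟩
    have : x = vert N s k := by
      rw [← sub_eq_zero]
      refine eq_of_full hli fun i hi => ?_
      have h1 := (vert_spec ⟨x, hx⟩).1.2 (s i) ⟨i, hi, rfl⟩
      have h2 := hx.2 (s i) ⟨i, hi, rfl⟩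
      rw [inner_sub_right, h1, h2, sub_self]
    rw [this]
    exact subset_convexHull _ _ ⟨k, by simp, rfl⟩
  | succ m ih =>
    intro k hk s x hs hli hx
    have hkd : k < d := by omega
    have hv := (vert_spec ⟨x, hx⟩).1
    have : ∃ w : E d, w ≠ 0 ∧ (∀ i < k, inner ℝ (s i) w = 0) ∧
        ∃ r : ℝ, 0 ≤ r ∧ x = vert N s k + r • w := by
      by_cases h : x = vert N s k
      · obtain ⟨w, h1, h2⟩ := exists_dir (s := s) hkd
        exact ⟨w, h1, h2, 0, le_rfl, by simpa using h⟩
      · refine ⟨x - vert N s k, sub_ne_zero.2 h, fun i hi => ?_, 1, zero_le_one, by simp⟩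
        rw [inner_sub_right, hx.2 _ ⟨i, hi, rfl⟩, hv.2 _ ⟨i, hi, rfl⟩, sub_self]
    obtain ⟨w, hw0, hwo, r, hr, hxr⟩ := this
    obtain ⟨y, hy, a, haN, hay, haw, hseg⟩ := exists_exit hb hv hx hw0 hwo hr hxr
    have hcong : ∀ i < k, Function.update s k a i = s i := fun i hi =>
      Function.update_of_ne (by omega) _ _
    have hli' : LinearIndependent ℝ (fun i : Fin (k + 1) => Function.update s k a i) := by
      have : (fun i : Fin (k + 1) => Function.update s k a i) =
          Fin.snoc (α := fun _ => E d) (fun i : Fin k => s i) a := by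
        ext i : 1
        refine Fin.lastCases ?_ (fun j => ?_) i
        · simp
        · simp [hcong j j.2]
      rw [this, linearIndependent_finSnoc]
      refine ⟨hli, fun hmem => haw (inner_span_zero ?_ hmem)⟩
      rintro _ ⟨i, rfl⟩
      exact hwo i i.2
    have hy' : y ∈ face N (pre (Function.update s k a) (k + 1)) := by
      rw [face_succ, pre_congr hcong]
      exact ⟨hy, by simpa using hay⟩
    obtain ⟨s', hfl, hs', hconv⟩ := ih (k + 1) (by omega) _ y (by
      intro i hi
      rcases Nat.lt_succ_iff_lt_or_eq.1 hi with h | rfl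
      · rw [hcong i h]; exact hs i h
      · simpa using haN) hli' hy'
    have hss : ∀ i < k, s' i = s i := fun i hi => by rw [hs' i (by omega), hcong i hi]
    refine ⟨s', hfl, hss, ?_⟩
    have hvk : vert N s' k = vert N s k := by unfold vert; rw [pre_congr hss]
    refine (convex_convexHull ℝ _).segment_subset ?_ ?_ hseg
    · rw [← hvk]; exact subset_convexHull _ _ ⟨k, ⟨le_rfl, hkd.le⟩, rfl⟩
    · exact convexHull_mono (Set.image_mono (Set.Icc_subset_Icc_left (by omega))) hconv

lemma cover {N : Finset (E d)} (hb : ∃ M, ∀ x ∈ cell N, ‖x‖ ≤ M) {x : E d} (hx : x ∈ cell N) :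
    ∃ s : ℕ → E d, IsFlag N s ∧ x ∈ convexHull ℝ (vert N s '' Set.Icc 0 d) := by
  obtain ⟨s, h1, -, h2⟩ := cover_aux hb d 0 (by omega) (fun _ => 0) x (by simp)
    (linearIndependent_empty_type) ⟨hx, by simp [pre]⟩
  exact ⟨s, h1, h2⟩

/-! ### Disjointness -/

noncomputable def tup (N : Finset (E d)) (s : ℕ → E d) : Fin d → E d :=
  fun i => vert N s ((i : ℕ) + 1)

lemma inner_vert_lt {N : Finset (E d)} {s : ℕ → E d} (h : IsFlag N s)
    (hli : LinearIndependent ℝ (tup N s)) {k : ℕ} (hk : k < d) :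
    inner ℝ (s k) (vert N s k) < ‖s k‖ ^ 2 / 2 := by
  have hm := h.vert_mem le_rfl hk.le
  refine lt_of_le_of_ne (hm.1 _ (h.mem k hk)) fun heq => ?_
  have hm' : vert N s k ∈ face N (pre s (k + 1)) := by
    rw [face_succ]; exact ⟨hm, heq⟩
  have h1 := vert_spec (h.face_ne hk.le)
  have h2 := vert_spec (h.face_ne (k := k + 1) hk)
  have heq' : vert N s k = vert N s (k + 1) :=
    near_unique hm' h2.1 (fun x hx => h1.2 x (face_anti N (pre_mono s (Nat.le_succ k)) hx)) h2.2
  rcases k with _ | k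
  · rw [vert_zero] at heq'
    have h0 : tup N s ⟨0, hk⟩ = 0 := heq'.symm
    exact hli.ne_zero _ h0
  · have : tup N s ⟨k, by omega⟩ = tup N s ⟨k + 1, hk⟩ := heq'
    have := hli.injective this
    simp at this

def PosComb (N : Finset (E d)) (s : ℕ → E d) (k : ℕ) (x : E d) : Prop :=
  ∃ α : ℕ → ℝ, (∀ i ∈ Finset.Ico k (d + 1), 0 < α i) ∧ ∑ i ∈ Finset.Ico k (d + 1), α i = 1 ∧
    x = ∑ i ∈ Finset.Ico k (d + 1), α i • vert N s i

lemma PosComb.mem {N : Finset (E d)} {s : ℕ → E d} (h : IsFlag N s) {k : ℕ} {x : E d}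
    (hx : PosComb N s k x) : x ∈ face N (pre s k) := by
  obtain ⟨α, h1, h2, rfl⟩ := hx
  refine (convex_face _ _).sum_mem (fun i hi => (h1 i hi).le) h2 fun i hi => ?_
  rw [Finset.mem_Ico] at hi
  exact h.vert_mem hi.1 (by omega)

lemma PosComb.step {N : Finset (E d)} {s : ℕ → E d} {k : ℕ} (hk : k < d) {x : E d}
    (hx : PosComb N s k x) : ∃ q : ℝ, 0 < q ∧ ∃ y, PosComb N s (k + 1) y ∧
      y = vert N s k + q • (x - vert N s k) := by
  obtain ⟨α, h1, h2, rfl⟩ := hx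
  rw [Finset.sum_eq_sum_Ico_succ_bot (by omega)] at h2
  have hpos : 0 < ∑ i ∈ Finset.Ico (k + 1) (d + 1), α i := by
    refine Finset.sum_pos (fun i hi => h1 i ?_) ⟨k + 1, by simp; omega⟩
    rw [Finset.mem_Ico] at hi ⊢
    omega
  have hα : 0 < 1 - α k := by linarith
  refine ⟨(1 - α k)⁻¹, by positivity, _,
    ⟨fun i => (1 - α k)⁻¹ * α i, fun i hi => ?_, ?_, rfl⟩, ?_⟩
  · have := h1 i (by rw [Finset.mem_Ico] at hi ⊢; omega)
    positivity
  · rw [← Finset.mul_sum, inv_mul_eq_one₀ hα.ne']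
    linarith
  · rw [Finset.sum_eq_sum_Ico_succ_bot (by omega) (fun i => α i • vert N s i)]
    simp_rw [mul_smul]
    rw [← Finset.smul_sum]
    set S := ∑ i ∈ Finset.Ico (k + 1) (d + 1), α i • vert N s i
    have : α k • vert N s k + S - vert N s k = S - (1 - α k) • vert N s k := by
      rw [sub_smul, one_smul]; abel
    rw [this, smul_sub, smul_smul, inv_mul_cancel₀ hα.ne', one_smul]
    abel

/-- The points `vert (k+1), …, vert d` affinely span the face. -/
lemma inner_const {N : Finset (E d)} {s : ℕ → E d} (h : IsFlag N s)
    (hli : LinearIndependent ℝ (tup N s)) {k : ℕ} (hk : k < d) {a : E d} {β : ℝ}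
    (ha : ∀ i, k + 1 ≤ i → i ≤ d → inner ℝ a (vert N s i) = β) {z : E d}
    (hz : z ∈ face N (pre s (k + 1))) : inner ℝ a z = β := by
  set W := Submodule.span ℝ (Set.range (fun i : Fin (k + 1) => s i)) with hW
  have hWr : Module.finrank ℝ W = k + 1 := by
    have hl : LinearIndependent ℝ (fun i : Fin (k + 1) => s i) :=
      h.li.comp (fun i : Fin (k + 1) => (⟨i, by omega⟩ : Fin d))
        (fun i j hij => by simpa [Fin.ext_iff] using hij)
    rw [hW, finrank_span_eq_card hl, Fintype.card_fin]
  have hWo := Submodule.finrank_add_finrank_orthogonal W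
  rw [hWr, finrank_euclideanSpace_fin] at hWo
  set p : Fin (d - k) → E d := fun j => vert N s (k + 1 + j) with hp
  have hpl : LinearIndependent ℝ p := by
    have := hli.comp (fun j : Fin (d - k) => (⟨k + j, by omega⟩ : Fin d))
        (fun i j hij => by simpa [Fin.ext_iff] using hij)
    have he : p = tup N s ∘ (fun j : Fin (d - k) => (⟨k + j, by omega⟩ : Fin d)) := by
      funext j
      show vert N s (k + 1 + j) = vert N s (k + j + 1)
      congr 1
      omega
    rw [he]
    exact this
  have hpa := hpl.affineIndependent
  have hUr := hpa.finrank_vectorSpan (n := d - k - 1) (by rw [Fintype.card_fin]; omega)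
  have hpm : ∀ j, p j ∈ face N (pre s (k + 1)) := fun j => h.vert_mem (by omega) (by omega)
  have hdiff : ∀ x ∈ face N (pre s (k + 1)), ∀ y ∈ face N (pre s (k + 1)), x - y ∈ Wᗮ := by
    intro x hx y hy
    rw [Submodule.mem_orthogonal]
    intro u hu
    refine inner_span_zero ?_ hu
    rintro _ ⟨i, rfl⟩
    rw [inner_sub_right, hx.2 _ ⟨i, i.2, rfl⟩, hy.2 _ ⟨i, i.2, rfl⟩, sub_self]
  have hUW : vectorSpan ℝ (Set.range p) ≤ Wᗮ := by
    rw [vectorSpan_def, Submodule.span_le]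
    rintro _ ⟨_, ⟨i, rfl⟩, _, ⟨j, rfl⟩, rfl⟩
    exact hdiff _ (hpm i) _ (hpm j)
  have heq : vectorSpan ℝ (Set.range p) = Wᗮ :=
    Submodule.eq_of_le_of_finrank_eq hUW (by omega)
  have hv : vert N s (k + 1) ∈ face N (pre s (k + 1)) := h.vert_mem le_rfl hk
  have hzU : z - vert N s (k + 1) ∈ vectorSpan ℝ (Set.range p) := by
    rw [heq]; exact hdiff _ hz _ hv
  rw [vectorSpan_def] at hzU
  have h0 : inner ℝ (z - vert N s (k + 1)) a = 0 := by
    refine inner_span_zero ?_ hzU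
    rintro _ ⟨_, ⟨i, rfl⟩, _, ⟨j, rfl⟩, rfl⟩
    simp only [vsub_eq_sub]
    rw [real_inner_comm, inner_sub_right, ha _ (by omega) (by omega), ha _ (by omega) (by omega),
      sub_self]
  rw [real_inner_comm, inner_sub_right, ha _ le_rfl hk] at h0
  linarith

lemma face_sub {N : Finset (E d)} {s s' : ℕ → E d} (h : IsFlag N s) (h' : IsFlag N s')
    (hli : LinearIndependent ℝ (tup N s)) {k : ℕ} (hk : k < d)
    (hF : face N (pre s k) = face N (pre s' k)) {y : E d} (hy : PosComb N s (k + 1) y)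
    (hy' : y ∈ face N (pre s' (k + 1))) : face N (pre s (k + 1)) ⊆ face N (pre s' (k + 1)) := by
  intro z hz
  rw [face_succ, ← hF]
  refine ⟨face_anti N (pre_mono s (Nat.le_succ k)) hz, inner_const h hli hk ?_ hz⟩
  obtain ⟨α, h1, h2, rfl⟩ := hy
  have hyk : inner ℝ (s' k) (∑ i ∈ Finset.Ico (k + 1) (d + 1), α i • vert N s i) =
      ‖s' k‖ ^ 2 / 2 := hy'.2 _ ⟨k, by simp, rfl⟩
  rw [inner_sum] at hyk
  simp_rw [inner_smul_right] at hyk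
  have hle : ∀ i ∈ Finset.Ico (k + 1) (d + 1),
      α i * inner ℝ (s' k) (vert N s i) ≤ α i * (‖s' k‖ ^ 2 / 2) := by
    intro i hi
    have hi' := Finset.mem_Ico.1 hi
    exact mul_le_mul_of_nonneg_left
      ((h.vert_mem hi'.1 (by omega)).1 _ (h'.mem k hk)) (h1 i hi).le
  have hsum : ∑ i ∈ Finset.Ico (k + 1) (d + 1), α i * inner ℝ (s' k) (vert N s i) =
      ∑ i ∈ Finset.Ico (k + 1) (d + 1), α i * (‖s' k‖ ^ 2 / 2) := by
    rw [hyk, ← Finset.sum_mul, h2, one_mul]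
  intro i hi1 hi2
  have hi : i ∈ Finset.Ico (k + 1) (d + 1) := Finset.mem_Ico.2 ⟨hi1, by omega⟩
  exact mul_left_cancel₀ (h1 i hi).ne' ((Finset.sum_eq_sum_iff_of_le hle).1 hsum i hi)

lemma q_le {N : Finset (E d)} {s : ℕ → E d} (h : IsFlag N s)
    (hli : LinearIndependent ℝ (tup N s)) {k : ℕ} (hk : k < d) {x y y' : E d} {q q' : ℝ}
    (hq : 0 < q)
    (hy : y ∈ face N (pre s (k + 1))) (hy' : y' ∈ cell N)
    (e : y = vert N s k + q • (x - vert N s k)) (e' : y' = vert N s k + q' • (x - vert N s k)) :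
    q' ≤ q := by
  have h1 := inner_vert_lt h hli hk
  have h2 := hy.2 _ ⟨k, by simp, rfl⟩
  have h3 := hy' _ (h.mem k hk)
  rw [e, inner_add_right, inner_smul_right] at h2
  rw [e', inner_add_right, inner_smul_right] at h3
  have h4 : 0 < inner ℝ (s k) (x - vert N s k) := by
    by_contra hcon
    push Not at hcon
    nlinarith
  by_contra hcon
  push Not at hcon
  nlinarith

lemma disj_aux {N : Finset (E d)} {s s' : ℕ → E d} (h : IsFlag N s) (h' : IsFlag N s')
    (hli : LinearIndependent ℝ (tup N s)) (hli' : LinearIndependent ℝ (tup N s')) {x : E d}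
    (hx : PosComb N s 0 x) (hx' : PosComb N s' 0 x) (k : ℕ) (hk : k ≤ d) :
    face N (pre s k) = face N (pre s' k) ∧ ∃ y, PosComb N s k y ∧ PosComb N s' k y := by
  induction k with
  | zero => exact ⟨by simp [pre], x, hx, hx'⟩
  | succ k ih =>
    obtain ⟨hF, x, hx, hx'⟩ := ih (by omega)
    have hv : vert N s k = vert N s' k := by unfold vert; rw [hF]
    obtain ⟨q, hq, y, hy, e⟩ := hx.step hk
    obtain ⟨q', hq', y', hy', e'⟩ := hx'.step hk
    have hym := hy.mem h
    have hym' := hy'.mem h'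
    have hqq : q = q' := by
      refine le_antisymm ?_ ?_
      · rw [hv] at e
        exact q_le h' hli' hk hq' hym' hym.1 e' e
      · rw [← hv] at e'
        exact q_le h hli hk hq hym hym'.1 e e'
    have hyy : y = y' := by rw [e, e', hv, hqq]
    subst hyy
    exact ⟨Set.Subset.antisymm (face_sub h h' hli hk hF hy hym')
      (face_sub h' h hli' hk hF.symm hy' hym), y, hy, hy'⟩

lemma tup_eq {N : Finset (E d)} {s s' : ℕ → E d} (h : IsFlag N s) (h' : IsFlag N s')
    (hli : LinearIndependent ℝ (tup N s)) (hli' : LinearIndependent ℝ (tup N s')) {x : E d}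
    (hx : PosComb N s 0 x) (hx' : PosComb N s' 0 x) : tup N s = tup N s' := by
  funext i
  unfold tup vert
  rw [(disj_aux h h' hli hli' hx hx' (i + 1) i.2).1]

/-! ### Comparison of quadratic forms -/

noncomputable def lin (f : Fin d → E d) : E d →ₗ[ℝ] E d :=
  ∑ i, (EuclideanSpace.proj i : E d →L[ℝ] ℝ).toLinearMap.smulRight (f i)

lemma lin_apply (f : Fin d → E d) (α : E d) : lin f α = ∑ i, α i • f i := by
  simp [lin]

noncomputable def gr (i : ℕ) : ℝ := 2 * ((i : ℝ) + 1) / ((i : ℝ) + 2)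

noncomputable def qf (α : E d) : ℝ :=
  ∑ i : Fin d, ∑ j : Fin d, α i * α j * gr (min (i : ℕ) (j : ℕ))

lemma norm_lin_sq (f : Fin d → E d) (α : E d) :
    ‖lin f α‖ ^ 2 = ∑ i : Fin d, ∑ j : Fin d, α i * α j * inner ℝ (f i) (f j) := by
  rw [lin_apply, ← real_inner_self_eq_norm_sq, sum_inner]
  refine Finset.sum_congr rfl fun i _ => ?_
  rw [inner_sum]
  refine Finset.sum_congr rfl fun j _ => ?_
  rw [inner_smul_left, inner_smul_right]
  simp only [conj_trivial]
  ring

lemma qf_le {f : Fin d → E d} (hf : ∀ i j : Fin d, i ≤ j → gr i ≤ inner ℝ (f i) (f j)) {α : E d}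
    (hα : ∀ i, 0 ≤ α i) : qf α ≤ ‖lin f α‖ ^ 2 := by
  rw [norm_lin_sq]
  unfold qf
  refine Finset.sum_le_sum fun i _ => Finset.sum_le_sum fun j _ => ?_
  refine mul_le_mul_of_nonneg_left ?_ (mul_nonneg (hα i) (hα j))
  rcases le_total i j with h | h
  · rw [min_eq_left (by exact_mod_cast h)]; exact hf i j h
  · rw [min_eq_right (by exact_mod_cast h), real_inner_comm]; exact hf j i h

lemma qf_eq {f : Fin d → E d} (hf : ∀ i j : Fin d, i ≤ j → inner ℝ (f i) (f j) = gr i) (α : E d) :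
    ‖lin f α‖ ^ 2 = qf α := by
  rw [norm_lin_sq]
  unfold qf
  refine Finset.sum_congr rfl fun i _ => Finset.sum_congr rfl fun j _ => ?_
  congr 1
  rcases le_total i j with h | h
  · rw [min_eq_left (by exact_mod_cast h)]; exact hf i j h
  · rw [min_eq_right (by exact_mod_cast h), real_inner_comm]; exact hf j i h

lemma circum {N : Finset (E d)} (h2 : ∀ a ∈ N, 2 ≤ ‖a‖)
    (h22 : ∀ a ∈ N, ∀ b ∈ N, a ≠ b → 2 ≤ ‖a - b‖) {s : ℕ → E d} (h : IsFlag N s) {k : ℕ}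
    (hk : k ≤ d) {x : E d} (hx : x ∈ face N (pre s k)) :
    2 * (k : ℝ) ≤ ((k : ℝ) + 1) * ‖x‖ ^ 2 := by
  set R := Finset.range k with hR
  set S := ∑ i ∈ R, s i with hS
  set Q := ∑ i ∈ R, ‖s i‖ ^ 2 with hQ
  have hlt : ∀ i ∈ R, i < d := fun i hi => (Finset.mem_range.1 hi).trans_le hk
  have hSx : 2 * inner ℝ S x = Q := by
    rw [hS, sum_inner, Finset.mul_sum]
    refine Finset.sum_congr rfl fun i hi => ?_
    rw [hx.2 _ ⟨i, Finset.mem_range.1 hi, rfl⟩]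
    ring
  have hQ4 : 4 * (k : ℝ) ≤ Q := by
    have : ∑ i ∈ R, (4 : ℝ) ≤ Q := Finset.sum_le_sum fun i hi => by
      have := h2 _ (h.mem i (hlt i hi))
      nlinarith
    simp [hR] at this
    linarith
  have hSS : ‖S‖ ^ 2 ≤ k * Q - 2 * k * (k - 1) := by
    have e1 : ‖S‖ ^ 2 = ∑ i ∈ R, ∑ j ∈ R, (‖s i‖ ^ 2 + ‖s j‖ ^ 2 - ‖s i - s j‖ ^ 2) / 2 := by
      rw [← real_inner_self_eq_norm_sq, hS, sum_inner]
      refine Finset.sum_congr rfl fun i _ => ?_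
      rw [inner_sum]
      refine Finset.sum_congr rfl fun j _ => ?_
      rw [norm_sub_sq_real]
      ring
    have e2 : ∑ i ∈ R, ∑ j ∈ R, (‖s i‖ ^ 2 + ‖s j‖ ^ 2 - ‖s i - s j‖ ^ 2) / 2 ≤
        ∑ i ∈ R, ∑ j ∈ R, (‖s i‖ ^ 2 / 2 + ‖s j‖ ^ 2 / 2 - 2 + if i = j then 2 else 0) := by
      refine Finset.sum_le_sum fun i hi => Finset.sum_le_sum fun j hj => ?_
      split_ifs with hij
      · subst hij; simp
      · have hne : s i ≠ s j := by
          intro he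
          have := h.li.injective (a₁ := ⟨i, hlt i hi⟩) (a₂ := ⟨j, hlt j hj⟩) he
          simp at this
          exact hij this
        have := h22 _ (h.mem i (hlt i hi)) _ (h.mem j (hlt j hj)) hne
        nlinarith
    have hQ2 : ∑ j ∈ R, ‖s j‖ ^ 2 / 2 = Q / 2 := by rw [hQ, Finset.sum_div]
    have e3 : ∑ i ∈ R, ∑ j ∈ R, (‖s i‖ ^ 2 / 2 + ‖s j‖ ^ 2 / 2 - 2 + if i = j then 2 else 0) =
        k * Q - 2 * k * (k - 1) := by
      have : ∀ i ∈ R, ∑ j ∈ R, (‖s i‖ ^ 2 / 2 + ‖s j‖ ^ 2 / 2 - 2 + if i = j then 2 else 0) =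
          k * (‖s i‖ ^ 2 / 2) + Q / 2 - 2 * k + 2 := by
        intro i hi
        rw [Finset.sum_add_distrib, Finset.sum_sub_distrib, Finset.sum_add_distrib,
          Finset.sum_ite_eq, if_pos hi, hQ2]
        simp only [Finset.sum_const, nsmul_eq_mul, hR, Finset.card_range]
        ring
      rw [Finset.sum_congr rfl this, Finset.sum_add_distrib, Finset.sum_sub_distrib,
        Finset.sum_add_distrib, ← Finset.mul_sum, hQ2]
      simp only [Finset.sum_const, nsmul_eq_mul, hR, Finset.card_range]
      ring
    linarith
  have hmain : 0 ≤ ‖((k : ℝ) + 1) • x - S‖ ^ 2 := sq_nonneg _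
  rw [norm_sub_sq_real, norm_smul, inner_smul_left, real_inner_comm, Real.norm_of_nonneg (by positivity)] at hmain
  simp only [conj_trivial] at hmain
  have hk0 : (0 : ℝ) < (k : ℝ) + 1 := by positivity
  have : 0 ≤ ((k : ℝ) + 1) * (((k : ℝ) + 1) * ‖x‖ ^ 2 - 2 * k) := by nlinarith
  have := nonneg_of_mul_nonneg_right this hk0
  linarith

lemma tup_gram {N : Finset (E d)} (h2 : ∀ a ∈ N, 2 ≤ ‖a‖)
    (h22 : ∀ a ∈ N, ∀ b ∈ N, a ≠ b → 2 ≤ ‖a - b‖) {s : ℕ → E d} (h : IsFlag N s)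
    (i j : Fin d) (hij : i ≤ j) : gr i ≤ inner ℝ (tup N s i) (tup N s j) := by
  have hij' : (i : ℕ) + 1 ≤ j + 1 := by
    have : (i : ℕ) ≤ j := hij
    omega
  have h1 := vert_spec (h.face_ne (k := i + 1) i.2)
  have h3 := h1.2 _ (h.vert_mem (k := i + 1) (j := j + 1) hij' j.2)
  refine le_trans ?_ h3
  have h4 := circum h2 h22 h (k := i + 1) i.2 h1.1
  unfold gr
  push_cast at h4
  rw [div_le_iff₀ (by positivity)]
  linarith

/-! ### The standard simplex -/

def Dl (d : ℕ) : Set (E d) := {α | (∀ i, 0 ≤ α i) ∧ ∑ i, α i ≤ 1}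
def Do (d : ℕ) : Set (E d) := {α | (∀ i, 0 < α i) ∧ ∑ i, α i < 1}
def Dq (d : ℕ) (l : ℝ) : Set (E d) := {α | qf α ≤ l ^ 2}

lemma isOpen_Do : IsOpen (Do d) := by
  have : Do d = (⋂ i, {α : E d | 0 < α i}) ∩ {α : E d | ∑ i, α i < 1} := by
    ext; simp [Do]
  rw [this]
  exact (isOpen_iInter_of_finite fun i => isOpen_lt (by fun_prop) (by fun_prop)).inter
    (isOpen_lt (by fun_prop) (by fun_prop))

lemma isClosed_Dq (l : ℝ) : IsClosed (Dq d l) := by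
  unfold Dq qf
  exact isClosed_le (by fun_prop) (by fun_prop)

lemma convex_Dl : Convex ℝ (Dl d) := by
  intro x hx y hy p q hp hq hpq
  refine ⟨fun i => ?_, ?_⟩
  · have := hx.1 i
    have := hy.1 i
    simp only [PiLp.add_apply, PiLp.smul_apply, smul_eq_mul]
    positivity
  · simp only [PiLp.add_apply, PiLp.smul_apply, smul_eq_mul]
    rw [Finset.sum_add_distrib, ← Finset.mul_sum, ← Finset.mul_sum]
    calc _ ≤ p * 1 + q * 1 := by
          gcongr
          · exact hx.2
          · exact hy.2
      _ = 1 := by linarith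

lemma Do_subset : Do d ⊆ Dl d := fun _ hx => ⟨fun i => (hx.1 i).le, hx.2.le⟩

lemma hyperplane_null {a : E d} (ha : a ≠ 0) (β : ℝ) : volume {x : E d | inner ℝ a x = β} = 0 := by
  let A : AffineSubspace ℝ (E d) :=
    { carrier := {x : E d | inner ℝ a x = β}
      smul_vsub_vadd_mem' := by
        intro c p q r hp hq hr
        simp only [Set.mem_ofPred_eq] at hp hq hr ⊢
        simp only [vsub_eq_sub, vadd_eq_add]
        rw [inner_add_right, inner_smul_right, inner_sub_right, hp, hq, hr]
        ring }
  have hA : A ≠ ⊤ := by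
    intro h
    have h0 : (0 : E d) ∈ A := by rw [h]; trivial
    have h1 : a ∈ A := by rw [h]; trivial
    have h0' : inner ℝ a (0 : E d) = β := h0
    have h1' : inner ℝ a a = β := h1
    rw [inner_zero_right] at h0'
    rw [← h0'] at h1'
    exact ha (inner_self_eq_zero.1 h1')
  exact Measure.addHaar_affineSubspace volume A hA

lemma Dl_diff_null (hd : 0 < d) : volume (Dl d \ Do d) = 0 := by
  have hsub : Dl d \ Do d ⊆ (⋃ i : Fin d, {α : E d | inner ℝ (EuclideanSpace.single i (1 : ℝ)) α = 0}) ∪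
      {α : E d | inner ℝ (WithLp.toLp 2 (fun _ : Fin d => (1 : ℝ)) : E d) α = 1} := by
    rintro α ⟨h1, h2⟩
    by_contra hcon
    simp only [Set.mem_union, Set.mem_iUnion, Set.mem_ofPred_eq, not_or, not_exists] at hcon
    refine h2 ⟨fun i => lt_of_le_of_ne (h1.1 i) fun h => hcon.1 i ?_,
      lt_of_le_of_ne h1.2 fun h => hcon.2 ?_⟩
    · rw [EuclideanSpace.inner_single_left]; simp [← h]
    · simp [PiLp.inner_apply, h]
  refine measure_mono_null hsub (measure_union_null (measure_iUnion_null fun i => ?_) ?_)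
  · refine hyperplane_null ?_ 0
    intro h
    have := congrArg (fun v : E d => v i) h
    simp at this
  · refine hyperplane_null ?_ 1
    intro h
    have := congrArg (fun v : E d => v ⟨0, hd⟩) h
    simp at this

lemma vol_Do (hd : 0 < d) (A : Set (E d)) : volume (Do d ∩ A) = volume (Dl d ∩ A) := by
  refine le_antisymm (measure_mono (Set.inter_subset_inter_left _ Do_subset)) ?_
  have : Dl d ∩ A ⊆ (Do d ∩ A) ∪ (Dl d \ Do d) := by
    intro x hx
    by_cases h : x ∈ Do d
    · exact Or.inl ⟨h, hx.2⟩
    · exact Or.inr ⟨hx.1, h⟩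
  calc _ ≤ volume ((Do d ∩ A) ∪ (Dl d \ Do d)) := measure_mono this
    _ ≤ _ := measure_union_le _ _
    _ = _ := by rw [Dl_diff_null hd, add_zero]

/-! ### The cell estimate -/

def fam (N : Finset (E d)) : Set (Fin d → E d) := {f | ∃ s, IsFlag N s ∧ f = tup N s}

lemma fam_finite (N : Finset (E d)) : (fam N).Finite := by
  have h1 : ((fun L => near (face N L)) '' (𝒫 (N : Set (E d)))).Finite :=
    (N.finite_toSet.finite_subsets).image _
  refine (Set.Finite.pi' (fun _ : Fin d => h1)).subset ?_
  rintro _ ⟨s, hs, rfl⟩ i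
  refine ⟨pre s (i + 1), ?_, rfl⟩
  rintro _ ⟨j, hj, rfl⟩
  have : j < (i : ℕ) + 1 := hj
  exact hs.mem j (by omega)

lemma lin_single (f : Fin d → E d) (i : Fin d) : lin f (EuclideanSpace.single i 1) = f i := by
  rw [lin_apply, Finset.sum_eq_single i]
  · simp
  · intro j _ hj; simp [hj]
  · simp

lemma cover_fam {N : Finset (E d)} (hb : ∃ M, ∀ x ∈ cell N, ‖x‖ ≤ M) {x : E d} (hx : x ∈ cell N) :
    ∃ f ∈ fam N, x ∈ lin f '' Dl d := by
  obtain ⟨s, hs, hxs⟩ := cover hb hx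
  refine ⟨tup N s, ⟨s, hs, rfl⟩, convexHull_min ?_ (convex_Dl.linear_image _) hxs⟩
  rintro _ ⟨i, hi, rfl⟩
  rcases i with _ | i
  · exact ⟨0, ⟨by simp, by simp⟩, by rw [vert_zero, map_zero]⟩
  · have hid : i < d := hi.2
    refine ⟨EuclideanSpace.single ⟨i, hid⟩ 1, ⟨fun j => ?_, ?_⟩, ?_⟩
    · by_cases h : j = ⟨i, hid⟩
      · simp [h]
      · simp [h]
    · rw [Finset.sum_eq_single ⟨i, hid⟩]
      · simp
      · intro j _ hj; simp [hj]
      · simp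
    · rw [lin_single]; rfl

lemma posComb_of_Do {N : Finset (E d)} {s : ℕ → E d} {α : E d} (hα : α ∈ Do d) :
    PosComb N s 0 (lin (tup N s) α) := by
  refine ⟨fun i => if h : i - 1 < d ∧ 0 < i then α ⟨i - 1, h.1⟩ else 1 - ∑ j, α j, ?_, ?_, ?_⟩
  · intro i hi
    simp only
    split_ifs with h
    · exact hα.1 _
    · linarith [hα.2]
  · rw [← Finset.range_eq_Ico, Finset.sum_range_succ', Finset.sum_range]
    simp
  · rw [← Finset.range_eq_Ico, Finset.sum_range_succ', Finset.sum_range, lin_apply, vert_zero]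
    simp [tup]

lemma lin_inj {f : Fin d → E d} (h : LinearMap.det (lin f) ≠ 0) : Function.Injective (lin f) := by
  have := LinearMap.bot_lt_ker_of_det_eq_zero (f := lin f)
  exact (LinearMap.equivOfDetNeZero (lin f) h).injective

lemma li_of_det {f : Fin d → E d} (h : LinearMap.det (lin f) ≠ 0) : LinearIndependent ℝ f := by
  rw [Fintype.linearIndependent_iff]
  intro g hg i
  have : lin f (WithLp.toLp 2 g) = lin f 0 := by
    rw [map_zero, lin_apply]; exact hg
  have := lin_inj h this
  exact congrArg (fun v : E d => v i) this

lemma image_meas {f : Fin d → E d} (h : LinearMap.det (lin f) ≠ 0) {A : Set (E d)}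
    (hA : MeasurableSet A) : MeasurableSet (lin f '' A) :=
  hA.image_of_continuousOn_injOn (lin f).continuous_of_finiteDimensional.continuousOn
    (lin_inj h).injOn

theorem cell_measure (hd : 0 < d) {N : Finset (E d)} (hb : ∃ M, ∀ x ∈ cell N, ‖x‖ ≤ M)
    (h2 : ∀ a ∈ N, 2 ≤ ‖a‖) (h22 : ∀ a ∈ N, ∀ b ∈ N, a ≠ b → 2 ≤ ‖a - b‖) (l : ℝ) :
    ∃ D : ENNReal, volume (cell N ∩ closedBall 0 l) ≤ D * volume (Dl d ∩ Dq d l) ∧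
      D * volume (Dl d) ≤ volume (cell N) := by
  classical
  set F := (fam_finite N).toFinset with hF
  have hFm : ∀ f, f ∈ F ↔ f ∈ fam N := fun f => by simp [hF]
  refine ⟨∑ f ∈ F, ENNReal.ofReal |LinearMap.det (lin f)|, ?_, ?_⟩
  · have hsub : cell N ∩ closedBall 0 l ⊆ ⋃ f ∈ F, lin f '' (Dl d ∩ Dq d l) := by
      rintro x ⟨hx, hxl⟩
      obtain ⟨f, hf, α, hα, rfl⟩ := cover_fam hb hx
      simp only [Set.mem_iUnion]
      refine ⟨f, (hFm f).2 hf, α, ⟨hα, ?_⟩, rfl⟩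
      obtain ⟨s, hs, rfl⟩ := hf
      have h1 := qf_le (tup_gram h2 h22 hs) hα.1
      rw [mem_closedBall_zero_iff] at hxl
      show qf α ≤ l ^ 2
      have := norm_nonneg (lin (tup N s) α)
      nlinarith
    refine (measure_mono hsub).trans ((measure_biUnion_finset_le _ _).trans ?_)
    rw [Finset.sum_mul]
    refine Finset.sum_le_sum fun f _ => ?_
    rw [Measure.addHaar_image_linearMap]
  · set F' := F.filter (fun f => LinearMap.det (lin f) ≠ 0) with hF'
    have hd1 : ∀ f ∈ F', LinearMap.det (lin f) ≠ 0 := fun f hf => (Finset.mem_filter.1 hf).2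
    have e1 : (∑ f ∈ F, ENNReal.ofReal |LinearMap.det (lin f)|) * volume (Dl d) =
        ∑ f ∈ F', volume (lin f '' Do d) := by
      rw [Finset.sum_mul, hF', Finset.sum_filter]
      refine Finset.sum_congr rfl fun f _ => ?_
      have := vol_Do hd (Set.univ)
      rw [Set.inter_univ, Set.inter_univ] at this
      rw [Measure.addHaar_image_linearMap, this]
      split_ifs with h
      · rfl
      · simp only [not_not] at h
        rw [h]; simp
    rw [e1, ← measure_biUnion_finset]
    · refine measure_mono ?_
      simp only [Set.iUnion_subset_iff]
      rintro f hf _ ⟨α, hα, rfl⟩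
      obtain ⟨s, hs, rfl⟩ := (hFm f).1 (Finset.mem_filter.1 hf).1
      exact ((posComb_of_Do hα).mem hs).1
    · intro f hf g hg hfg
      rw [Function.onFun, Set.disjoint_left]
      rintro _ ⟨α, hα, rfl⟩ ⟨β, hβ, he⟩
      have hf1 := hd1 f hf
      have hg1 := hd1 g hg
      obtain ⟨s, hs, rfl⟩ := (hFm f).1 (Finset.mem_filter.1 hf).1
      obtain ⟨s', hs', rfl⟩ := (hFm g).1 (Finset.mem_filter.1 hg).1
      refine hfg (tup_eq hs hs' (li_of_det hf1) (li_of_det hg1) (posComb_of_Do hα) ?_)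
      rw [← he]
      exact posComb_of_Do hβ
    · intro f hf
      exact image_meas (hd1 f hf) isOpen_Do.measurableSet

/-! ### The regular simplex -/

def Reg (t : Fin (d + 1) → E d) : Prop := ∀ i j : Fin (d + 1), i ≠ j → ‖t i - t j‖ = 2

lemma Reg.inner_eq {t : Fin (d + 1) → E d} (ht : Reg t) (o i j : Fin (d + 1)) :
    inner ℝ (t i - t o) (t j - t o) =
      2 * (1 - (if i = o then 1 else 0) - (if j = o then 1 else 0) + if i = j then 1 else 0) := by
  have key : ∀ a b, ‖t a - t b‖ ^ 2 = 4 * (1 - if a = b then (1 : ℝ) else 0) := by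
    intro a b
    split_ifs with h
    · simp [h]
    · rw [ht a b h]; norm_num
  have h1 := norm_sub_sq_real (t i - t o) (t j - t o)
  rw [sub_sub_sub_cancel_right, key, key, key] at h1
  linarith

noncomputable def wv (t : Fin (d + 1) → E d) (k : Fin d) : E d :=
  ((k : ℝ) + 2)⁻¹ • ∑ i : Fin (d + 1), if (i : ℕ) ≤ k + 1 then t i - t 0 else 0

lemma card_le (k : Fin d) :
    (Finset.univ.filter (fun i : Fin (d + 1) => (i : ℕ) ≤ k + 1)).card = k + 2 := by
  have := Fin.card_filter_val_lt (n := d + 1) (m := k + 2)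
  rw [min_eq_right (by omega)] at this
  rw [← this]
  congr 1
  ext i
  simp
  omega

lemma wv_gram {t : Fin (d + 1) → E d} (ht : Reg t) (k m : Fin d) (hkm : k ≤ m) :
    inner ℝ (wv t k) (wv t m) = gr k := by
  have hkm' : (k : ℕ) ≤ m := hkm
  unfold wv gr
  rw [inner_smul_left, inner_smul_right, ← Finset.sum_filter, ← Finset.sum_filter, sum_inner]
  simp_rw [inner_sum, ht.inner_eq, ← Finset.mul_sum, Finset.sum_add_distrib, Finset.sum_sub_distrib,
    Finset.sum_ite_eq']
  have h1 : ∑ i ∈ Finset.univ.filter (fun i : Fin (d + 1) => (i : ℕ) ≤ k + 1),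
      ∑ j ∈ Finset.univ.filter (fun j : Fin (d + 1) => (j : ℕ) ≤ m + 1), (if i = j then (1 : ℝ) else 0)
        = k + 2 := by
    rw [Finset.sum_congr rfl (g := fun _ => (1 : ℝ))]
    · rw [Finset.sum_const, card_le]; simp
    · intro i hi
      rw [Finset.sum_ite_eq, if_pos]
      simp at hi ⊢
      omega
  rw [h1]
  simp only [Finset.sum_const, card_le, nsmul_eq_mul, Finset.sum_ite_eq', ← Finset.mul_sum]
  simp
  field_simp
  ring

noncomputable def bc (α : E d) (i : Fin (d + 1)) : ℝ :=
  (if i = 0 then 1 - ∑ k, α k else 0) +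
    ∑ k : Fin d, if (i : ℕ) ≤ k + 1 then α k * ((k : ℝ) + 2)⁻¹ else 0

lemma bc_sum (α : E d) : ∑ i, bc α i = 1 := by
  unfold bc
  rw [Finset.sum_add_distrib, Finset.sum_comm, Finset.sum_ite_eq']
  simp only [Finset.mem_univ, if_true]
  have : ∀ k : Fin d, ∑ i : Fin (d + 1), (if (i : ℕ) ≤ k + 1 then α k * ((k : ℝ) + 2)⁻¹ else 0)
      = α k := by
    intro k
    rw [← Finset.sum_filter, Finset.sum_const, card_le, nsmul_eq_mul]
    push_cast
    field_simp
  simp_rw [this]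
  ring

lemma bc_comb (t : Fin (d + 1) → E d) (α : E d) :
    ∑ i, bc α i • t i = t 0 + lin (wv t) α := by
  have h1 : ∑ i, bc α i • t i = t 0 + ∑ i, bc α i • (t i - t 0) := by
    simp_rw [smul_sub]
    rw [Finset.sum_sub_distrib, ← Finset.sum_smul, bc_sum, one_smul]
    abel
  rw [h1, lin_apply]
  congr 1
  unfold bc wv
  simp_rw [add_smul, Finset.sum_add_distrib, Finset.sum_smul, smul_smul, Finset.smul_sum]
  rw [Finset.sum_comm]
  have h2 : ∑ i : Fin (d + 1), (if i = 0 then 1 - ∑ k, α k else 0) • (t i - t 0) = 0 := by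
    refine Finset.sum_eq_zero fun i _ => ?_
    split_ifs with h
    · simp [h]
    · simp
  rw [h2, zero_add]
  refine Finset.sum_congr rfl fun k _ => Finset.sum_congr rfl fun i _ => ?_
  split_ifs <;> simp

lemma bc_nonneg {α : E d} (hα : α ∈ Dl d) (i : Fin (d + 1)) : 0 ≤ bc α i := by
  unfold bc
  refine add_nonneg ?_ (Finset.sum_nonneg fun k _ => ?_)
  · split_ifs
    · linarith [hα.2]
    · exact le_rfl
  · split_ifs
    · exact mul_nonneg (hα.1 k) (by positivity)
    · exact le_rfl

lemma bc_strictAnti {α : E d} (hα : α ∈ Do d) : StrictAnti (bc α) := by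
  intro i j hij
  have hij' : (i : ℕ) < j := hij
  have hj : j ≠ 0 := fun h => by rw [h] at hij'; simp at hij'
  have hle : ∀ k ∈ Finset.univ, (if (j : ℕ) ≤ ((k : Fin d) : ℕ) + 1 then α k * ((k : ℝ) + 2)⁻¹ else 0) ≤
      if (i : ℕ) ≤ k + 1 then α k * ((k : ℝ) + 2)⁻¹ else 0 := by
    intro k _
    have : 0 < α k * ((k : ℝ) + 2)⁻¹ := mul_pos (hα.1 k) (by positivity)
    split_ifs <;> first | omega | linarith
  unfold bc
  rw [if_neg hj]
  by_cases hi : i = 0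
  · rw [if_pos hi]
    have := Finset.sum_le_sum hle
    linarith [hα.2]
  · rw [if_neg hi, zero_add, zero_add]
    have hi' : (i : ℕ) ≠ 0 := fun h => hi (Fin.ext h)
    refine Finset.sum_lt_sum hle ⟨⟨i - 1, by omega⟩, Finset.mem_univ _, ?_⟩
    have := hα.1 ⟨i - 1, by omega⟩
    rw [if_neg (by simp; omega), if_pos (by simp; omega)]
    positivity

lemma tele (B : ℕ → ℝ) (i n : ℕ) (hi : 1 ≤ i) :
    ∑ k ∈ Finset.range n, (if i ≤ k + 1 then B (k + 1) - B (k + 2) else 0) =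
      if i ≤ n then B i - B (n + 1) else 0 := by
  induction n with
  | zero => rw [if_neg (by omega)]; simp
  | succ n ih =>
    rw [Finset.sum_range_succ, ih]
    rcases lt_trichotomy i (n + 1) with h | h | h
    · rw [if_pos (by omega), if_pos (by omega), if_pos (by omega)]; ring
    · rw [if_neg (by omega), if_pos (by omega), if_pos (by omega), h]; ring
    · rw [if_neg (by omega), if_neg (by omega), if_neg (by omega)]; ring

lemma bc_surj (hd : 0 < d) {β : Fin (d + 1) → ℝ} (hβ : Antitone β) (h0 : ∀ i, 0 ≤ β i)
    (h1 : ∑ i, β i = 1) : ∃ α ∈ Dl d, bc α = β := by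
  set B : ℕ → ℝ := fun i => if h : i < d + 1 then β ⟨i, h⟩ else 0 with hB
  have hBd : B (d + 1) = 0 := by simp [hB]
  have hBi : ∀ i : Fin (d + 1), B i = β i := fun i => by
    simp only [hB]
    rw [dif_pos i.2]
  have hBanti : ∀ i, B (i + 1) ≤ B i := by
    intro i
    simp only [hB]
    split_ifs with h h'
    · exact hβ (by simp [Fin.le_def])
    · omega
    · exact h0 _
    · exact le_rfl
  set α : E d := WithLp.toLp 2 (fun k : Fin d => ((k : ℝ) + 2) * (B (k + 1) - B (k + 2))) with hα
  have hsum : ∀ i : Fin (d + 1), 1 ≤ (i : ℕ) →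
      (∑ k : Fin d, if (i : ℕ) ≤ k + 1 then α k * ((k : ℝ) + 2)⁻¹ else 0) = β i := by
    intro i hi
    have := tele B i d hi
    rw [if_pos (by omega), hBd, sub_zero, hBi, Finset.sum_range] at this
    rw [← this]
    refine Finset.sum_congr rfl fun k _ => ?_
    split_ifs
    · simp only [hα]
      field_simp
    · rfl
  have hbc : ∀ i : Fin (d + 1), i ≠ 0 → bc α i = β i := by
    intro i hi
    unfold bc
    rw [if_neg hi, zero_add, hsum i]
    have : (i : ℕ) ≠ 0 := fun h => hi (Fin.ext h)
    omega
  have hbc0 : bc α 0 = β 0 := by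
    have e1 := bc_sum α
    rw [← h1, Fin.sum_univ_succ, Fin.sum_univ_succ] at e1
    have : ∑ i : Fin d, bc α i.succ = ∑ i : Fin d, β i.succ :=
      Finset.sum_congr rfl fun i _ => hbc _ (Fin.succ_ne_zero i)
    linarith
  have hsum0 : (∑ k : Fin d, if ((0 : Fin (d + 1)) : ℕ) ≤ k + 1 then α k * ((k : ℝ) + 2)⁻¹ else 0) =
      β ⟨1, by omega⟩ := by
    rw [← hsum ⟨1, by omega⟩ le_rfl]
    refine Finset.sum_congr rfl fun k _ => ?_
    simp
  refine ⟨α, ⟨fun k => ?_, ?_⟩, ?_⟩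
  · simp only [hα]
    have := hBanti (k + 1)
    exact mul_nonneg (by positivity) (by linarith)
  · have e2 := hbc0
    unfold bc at e2
    rw [hsum0, if_pos rfl] at e2
    have : β ⟨1, by omega⟩ ≤ β 0 := hβ (Fin.zero_le _)
    linarith
  · funext i
    by_cases hi : i = 0
    · rw [hi]; exact hbc0
    · exact hbc i hi

lemma Reg.unique {t : Fin (d + 1) → E d} (ht : Reg t) {b : Fin (d + 1) → ℝ} (hb : ∑ i, b i = 0)
    (hbt : ∑ i, b i • t i = 0) (j : Fin (d + 1)) : b j = 0 := by
  have h1 : ∑ i, b i • (t i - t 0) = 0 := by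
    simp_rw [smul_sub]
    rw [Finset.sum_sub_distrib, ← Finset.sum_smul, hb, hbt]
    simp
  have h2 : ∀ j, b j = b 0 := by
    intro j
    have h3 : inner ℝ (∑ i, b i • (t i - t 0)) (t j - t 0) = 0 := by rw [h1, inner_zero_left]
    rw [sum_inner] at h3
    simp_rw [inner_smul_left, ht.inner_eq, mul_add, mul_sub] at h3
    simp only [Finset.sum_add_distrib, Finset.sum_sub_distrib, conj_trivial] at h3
    simp [← Finset.sum_mul, hb] at h3
    linarith
  have h4 : ∑ i, b i = ((d : ℝ) + 1) * b 0 := by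
    rw [Finset.sum_congr rfl fun i _ => h2 i]; simp
  rw [hb] at h4
  have h5 : b 0 = 0 := by
    have : (d : ℝ) + 1 ≠ 0 := by positivity
    rcases mul_eq_zero.1 h4.symm with h | h
    · exact absurd h this
    · exact h
  rw [h2 j, h5]

lemma Reg.comp {t : Fin (d + 1) → E d} (ht : Reg t) (π : Equiv.Perm (Fin (d + 1))) :
    Reg (t ∘ π) := fun _ _ hij => ht _ _ (fun h => hij (π.injective h))

lemma perm_eq {t : Fin (d + 1) → E d} (ht : Reg t) {π π' : Equiv.Perm (Fin (d + 1))} {α α' : E d}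
    (hα : α ∈ Do d) (hα' : α' ∈ Do d)
    (h : ∑ i, bc α i • t (π i) = ∑ i, bc α' i • t (π' i)) : π = π' := by
  have e1 : ∑ i, bc α i • t (π i) = ∑ i, bc α (π.symm i) • t i := by
    rw [← Equiv.sum_comp π (fun i => bc α (π.symm i) • t i)]; simp
  have e2 : ∑ i, bc α' i • t (π' i) = ∑ i, bc α' (π'.symm i) • t i := by
    rw [← Equiv.sum_comp π' (fun i => bc α' (π'.symm i) • t i)]; simp
  have hb : ∀ j, bc α (π.symm j) = bc α' (π'.symm j) := by
    intro j
    rw [← sub_eq_zero]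
    refine ht.unique (b := fun j => bc α (π.symm j) - bc α' (π'.symm j)) ?_ ?_ j
    · rw [Finset.sum_sub_distrib, Equiv.sum_comp π.symm, Equiv.sum_comp π'.symm, bc_sum, bc_sum,
        sub_self]
    · simp_rw [sub_smul]
      rw [Finset.sum_sub_distrib, ← e1, ← e2, h, sub_self]
  have hmono : StrictMono (fun i => π.symm (π' i)) := by
    intro i j hij
    have := bc_strictAnti hα' hij
    have h1 := hb (π' i)
    have h2 := hb (π' j)
    rw [Equiv.symm_apply_apply] at h1 h2
    rw [← h1, ← h2] at this
    exact (bc_strictAnti hα).lt_iff_gt.1 this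
  have hid : (fun i => π.symm (π' i)) = id := by
    refine (hmono.range_inj strictMono_id).1 ?_
    rw [Set.range_id]
    exact ((π'.trans π.symm).surjective).range_eq
  ext i
  have := congrFun hid i
  simp only [id] at this
  rw [Equiv.symm_apply_eq] at this
  rw [this]

lemma hull_mem {t : Fin (d + 1) → E d} {x : E d} (hx : x ∈ convexHull ℝ (Set.range t)) :
    ∃ b : Fin (d + 1) → ℝ, (∀ i, 0 ≤ b i) ∧ ∑ i, b i = 1 ∧ x = ∑ i, b i • t i := by
  have hc : Convex ℝ {x | ∃ b : Fin (d + 1) → ℝ, (∀ i, 0 ≤ b i) ∧ ∑ i, b i = 1 ∧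
      x = ∑ i, b i • t i} := by
    rintro _ ⟨b, h1, h2, rfl⟩ _ ⟨b', h1', h2', rfl⟩ p q hp hq hpq
    refine ⟨fun i => p * b i + q * b' i, fun i => ?_, ?_, ?_⟩
    · have := h1 i
      have := h1' i
      positivity
    · rw [Finset.sum_add_distrib, ← Finset.mul_sum, ← Finset.mul_sum, h2, h2']
      linarith
    · simp_rw [add_smul, mul_smul]
      rw [Finset.sum_add_distrib, ← Finset.smul_sum, ← Finset.smul_sum]
  refine convexHull_min ?_ hc hx
  rintro _ ⟨i, rfl⟩
  refine ⟨Pi.single i 1, fun j => ?_, by simp, ?_⟩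
  · by_cases h : j = i
    · subst h; simp
    · simp [h]
  · rw [Finset.sum_eq_single i]
    · simp
    · intro j _ hj; simp [hj]
    · simp

theorem simplex_measure (hd : 0 < d) {t : Fin (d + 1) → E d} (ht : Reg t) {l : ℝ} (hl : 0 ≤ l) :
    ∃ D : ENNReal, volume (convexHull ℝ (Set.range t)) ≤ D * volume (Dl d) ∧
      D * volume (Dl d ∩ Dq d l) ≤
        volume (convexHull ℝ (Set.range t) ∩ ⋃ i : Fin (d + 1), closedBall (t i) l) := by
  classical
  have hvol : ∀ (π : Equiv.Perm (Fin (d + 1))) (A : Set (E d)),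
      volume ((fun x => t (π 0) + x) '' (lin (wv (t ∘ π)) '' A)) =
        ENNReal.ofReal |LinearMap.det (lin (wv (t ∘ π)))| * volume A := by
    intro π A
    rw [Set.image_add_left, measure_preimage_add, Measure.addHaar_image_linearMap]
  refine ⟨∑ π : Equiv.Perm (Fin (d + 1)), ENNReal.ofReal |LinearMap.det (lin (wv (t ∘ π)))|, ?_, ?_⟩
  · have hsub : convexHull ℝ (Set.range t) ⊆ ⋃ π ∈ (Finset.univ : Finset (Equiv.Perm (Fin (d + 1)))),
        (fun x => t (π 0) + x) '' (lin (wv (t ∘ π)) '' Dl d) := by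
      intro x hx
      obtain ⟨b, h0, h1, rfl⟩ := hull_mem hx
      set π := Tuple.sort (fun i => - b i) with hπ
      have hm := Tuple.monotone_sort (fun i => - b i)
      have hanti : Antitone (b ∘ π) := by
        intro i j hij
        have := hm hij
        simp only [Function.comp] at this ⊢
        linarith
      obtain ⟨α, hα, hbc⟩ := bc_surj hd hanti (fun i => h0 _) (by
        rw [← h1]; exact Equiv.sum_comp π b)
      simp only [Set.mem_iUnion]
      refine ⟨π, Finset.mem_univ _, lin (wv (t ∘ π)) α, ⟨α, hα, rfl⟩, ?_⟩
      have := bc_comb (t ∘ π) α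
      rw [hbc] at this
      simp only [Function.comp] at this ⊢
      rw [← this]
      exact Equiv.sum_comp π (fun i => b i • t i)
    refine (measure_mono hsub).trans ((measure_biUnion_finset_le _ _).trans ?_)
    rw [Finset.sum_mul]
    refine Finset.sum_le_sum fun π _ => ?_
    rw [hvol]
  · set F' : Finset (Equiv.Perm (Fin (d + 1))) := Finset.univ.filter
      (fun π : Equiv.Perm (Fin (d + 1)) => LinearMap.det (lin (wv (t ∘ π))) ≠ 0) with hF'
    have hd1 : ∀ π : Equiv.Perm (Fin (d + 1)), π ∈ F' → LinearMap.det (lin (wv (t ∘ π))) ≠ 0 :=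
      fun f hf => (Finset.mem_filter.1 hf).2
    set G : Equiv.Perm (Fin (d + 1)) → Set (E d) := fun π =>
      (fun x => t (π 0) + x) '' (lin (wv (t ∘ π)) '' (Do d ∩ Dq d l)) with hG
    have e1 : (∑ π : Equiv.Perm (Fin (d + 1)),
          ENNReal.ofReal |LinearMap.det (lin (wv (t ∘ π)))|) * volume (Dl d ∩ Dq d l) =
        ∑ π ∈ F', volume (G π) := by
      rw [Finset.sum_mul, hF', Finset.sum_filter]
      refine Finset.sum_congr rfl fun π _ => ?_
      simp only [hG]
      rw [hvol, vol_Do hd]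
      split_ifs with h
      · rfl
      · simp only [not_not] at h
        rw [h]; simp
    rw [e1, ← measure_biUnion_finset]
    · refine measure_mono ?_
      simp only [Set.iUnion_subset_iff]
      rintro π hf _ ⟨_, ⟨α, hα, rfl⟩, rfl⟩
      refine ⟨?_, ?_⟩
      · have := bc_comb (t ∘ π) α
        simp only [Function.comp] at this ⊢
        rw [← this]
        exact (convex_convexHull ℝ _).sum_mem (fun i _ => bc_nonneg (Do_subset hα.1) i) (bc_sum α)
          (fun i _ => subset_convexHull _ _ ⟨_, rfl⟩)
      · simp only [Set.mem_iUnion]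
        refine ⟨π 0, ?_⟩
        rw [mem_closedBall, dist_eq_norm, add_sub_cancel_left]
        have h1 := qf_eq (wv_gram (ht.comp π)) α
        have h2 : qf α ≤ l ^ 2 := hα.2
        rw [← h1] at h2
        exact (sq_le_sq₀ (norm_nonneg _) hl).1 h2
    · intro π hf π' hg hfg
      rw [Function.onFun, Set.disjoint_left]
      rintro _ ⟨_, ⟨α, hα, rfl⟩, rfl⟩ ⟨_, ⟨β, hβ, rfl⟩, he⟩
      refine hfg (perm_eq ht hα.1 hβ.1 ?_)
      have h1 := bc_comb (t ∘ π) α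
      have h2 := bc_comb (t ∘ π') β
      simp only [Function.comp] at h1 h2 he
      rw [h1, h2]
      exact he.symm
    · intro π hf
      have := image_meas (hd1 π hf) (isOpen_Do.measurableSet.inter (isClosed_Dq l).measurableSet)
      simp only [hG]
      rw [Set.image_add_left]
      exact this.preimage (measurable_const_add _)

/-! ### Voronoi cells of saturated packings -/

lemma cell_ratio (hd : 0 < d) {t : Fin (d + 1) → E d} (ht : Reg t) {l : ℝ} (hl : 0 ≤ l)
    {N : Finset (E d)} (hb : ∃ M, ∀ x ∈ cell N, ‖x‖ ≤ M) (h2 : ∀ a ∈ N, 2 ≤ ‖a‖)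
    (h22 : ∀ a ∈ N, ∀ b ∈ N, a ≠ b → 2 ≤ ‖a - b‖) :
    volume (cell N ∩ closedBall 0 l) * volume (convexHull ℝ (Set.range t)) ≤
      volume (cell N) *
        volume (convexHull ℝ (Set.range t) ∩ ⋃ i : Fin (d + 1), closedBall (t i) l) := by
  obtain ⟨D, hD1, hD2⟩ := cell_measure hd hb h2 h22 l
  obtain ⟨D', hD1', hD2'⟩ := simplex_measure hd ht hl
  calc _ ≤ (D * volume (Dl d ∩ Dq d l)) * (D' * volume (Dl d)) := mul_le_mul' hD1 hD1'
    _ = (D * volume (Dl d)) * (D' * volume (Dl d ∩ Dq d l)) := by ring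
    _ ≤ _ := mul_le_mul' hD2 hD2'

def Sep (C : Set (E d)) : Prop := ∀ a ∈ C, ∀ b ∈ C, a ≠ b → 2 ≤ ‖a - b‖

def Sat (C : Set (E d)) : Prop := ∀ x, ∃ c ∈ C, ‖x - c‖ < 2

lemma exists_sat {C₀ : Set (E d)} (h : Sep C₀) : ∃ C, C₀ ⊆ C ∧ Sep C ∧ Sat C := by
  obtain ⟨C, hC, hmax⟩ := zorn_subset_nonempty {C : Set (E d) | Sep C} (by
    intro S hS hch _
    refine ⟨⋃₀ S, ?_, fun s hs => Set.subset_sUnion_of_mem hs⟩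
    rintro a ⟨s, hs, has⟩ b ⟨s', hs', hbs⟩ hab
    rcases hch.total hs hs' with hss | hss
    · exact hS hs' a (hss has) b hbs hab
    · exact hS hs a has b (hss hbs) hab) C₀ h
  refine ⟨C, hC, hmax.prop, fun x => ?_⟩
  by_contra! hx
  have hs : Sep (insert x C) := by
    rintro a (rfl | ha) b (rfl | hb) hab
    · exact absurd rfl hab
    · exact hx b hb
    · rw [norm_sub_rev]; exact hx a ha
    · exact hmax.prop a ha b hb hab
  have := hmax.le_of_ge hs (Set.subset_insert x C) (Set.mem_insert x C)
  have h2 := hx x this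
  simp at h2
  linarith

lemma Sep.finite {C : Set (E d)} (h : Sep C) (p : E d) (r : ℝ) : (C ∩ closedBall p r).Finite := by
  obtain ⟨S, hS, hcov⟩ := Metric.totallyBounded_iff.1
    (isCompact_closedBall p r).totallyBounded 1 one_pos
  have : ∀ x : E d, ∃ y, x ∈ C ∩ closedBall p r → y ∈ S ∧ dist x y < 1 := by
    intro x
    by_cases hx : x ∈ C ∩ closedBall p r
    · have := hcov hx.2
      simp only [Set.mem_iUnion, mem_ball] at this
      obtain ⟨y, hy, hxy⟩ := this
      exact ⟨y, fun _ => ⟨hy, hxy⟩⟩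
    · exact ⟨0, fun h => absurd h hx⟩
  choose f hf using this
  refine Set.Finite.of_injOn (f := f) (fun x hx => (hf x hx).1) ?_ hS
  intro x hx y hy hxy
  by_contra hne
  have h1 := (hf x hx).2
  have h2 := (hf y hy).2
  rw [← hxy] at h2
  have h3 := h x hx.1 y hy.1 hne
  rw [← dist_eq_norm] at h3
  have := dist_triangle_right x y (f x)
  linarith

def vor (C : Set (E d)) (c : E d) : Set (E d) := {x | ∀ c' ∈ C, ‖x - c‖ ≤ ‖x - c'‖}

lemma isClosed_vor (C : Set (E d)) (c : E d) : IsClosed (vor C c) := by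
  have : vor C c = ⋂ c' ∈ C, {x | ‖x - c‖ ≤ ‖x - c'‖} := by
    ext x; simp [vor]
  rw [this]
  exact isClosed_biInter fun c' _ => isClosed_le (by fun_prop) (by fun_prop)

lemma vor_norm {C : Set (E d)} (hs : Sat C) {c x : E d} (hx : x ∈ vor C c) : ‖x - c‖ < 2 := by
  obtain ⟨c', hc', h⟩ := hs x
  exact (hx c' hc').trans_lt h

lemma half_iff (y a : E d) : inner ℝ a y ≤ ‖a‖ ^ 2 / 2 ↔ ‖y‖ ≤ ‖y - a‖ := by
  rw [← sq_le_sq₀ (norm_nonneg _) (norm_nonneg _), norm_sub_sq_real, real_inner_comm]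
  constructor <;> intro h <;> linarith

lemma vor_ratio (hd : 0 < d) {t : Fin (d + 1) → E d} (ht : Reg t) {l : ℝ} (hl : 0 ≤ l)
    {C : Set (E d)} (hC : Sep C) (hs : Sat C) {c : E d} (hc : c ∈ C) :
    volume (vor C c ∩ closedBall c l) * volume (convexHull ℝ (Set.range t)) ≤
      volume (vor C c) *
        volume (convexHull ℝ (Set.range t) ∩ ⋃ i : Fin (d + 1), closedBall (t i) l) := by
  classical
  set N : Finset (E d) := ((hC.finite c 5).toFinset.erase c).image (fun x => x - c) with hN
  have hmem : ∀ a, a ∈ N ↔ ∃ c' ∈ C, c' ≠ c ∧ ‖c' - c‖ ≤ 5 ∧ c' - c = a := by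
    intro a
    simp only [hN, Finset.mem_image, Finset.mem_erase, Set.Finite.mem_toFinset, Set.mem_inter_iff,
      mem_closedBall, dist_eq_norm]
    constructor
    · rintro ⟨c', ⟨h1, h2, h3⟩, h4⟩; exact ⟨c', h2, h1, h3, h4⟩
    · rintro ⟨c', h2, h1, h3, h4⟩; exact ⟨c', ⟨h1, h2, h3⟩, h4⟩
  have hbd : ∀ y ∈ cell N, ‖y‖ ≤ 2 := by
    intro y hy
    by_contra! h
    have hy0 : 0 < ‖y‖ := by linarith
    set s := min ‖y‖ 3 / ‖y‖ with hsdef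
    have hs1 : s ≤ 1 := (div_le_one hy0).2 (min_le_left _ _)
    have hs0 : 0 ≤ s := by positivity
    have hzn : ‖s • y‖ = min ‖y‖ 3 := by
      rw [norm_smul, Real.norm_of_nonneg hs0, hsdef]; field_simp
    have hz2 : 2 < ‖s • y‖ := by rw [hzn]; exact lt_min h (by norm_num)
    have hz3 : ‖s • y‖ ≤ 3 := by rw [hzn]; exact min_le_right _ _
    obtain ⟨c', hc', hcl⟩ := hs (c + s • y)
    have e : c + s • y - c' = s • y - (c' - c) := by abel
    rw [e] at hcl
    have hne : c' ≠ c := by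
      rintro rfl
      simp only [sub_self, sub_zero] at hcl
      linarith
    have h5 : ‖c' - c‖ ≤ 5 := by
      have := norm_sub_norm_le (c' - c) (s • y)
      rw [norm_sub_rev (c' - c) (s • y)] at this
      linarith
    have h6 : inner ℝ (c' - c) y ≤ ‖c' - c‖ ^ 2 / 2 := hy _ ((hmem _).2 ⟨c', hc', hne, h5, rfl⟩)
    have h7 : inner ℝ (c' - c) (s • y) ≤ ‖c' - c‖ ^ 2 / 2 := by
      rw [inner_smul_right]
      have h8 : s * inner ℝ (c' - c) y ≤ s * (‖c' - c‖ ^ 2 / 2) := mul_le_mul_of_nonneg_left h6 hs0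
      have h9 : s * (‖c' - c‖ ^ 2 / 2) ≤ 1 * (‖c' - c‖ ^ 2 / 2) :=
        mul_le_mul_of_nonneg_right hs1 (by positivity)
      linarith
    have := (half_iff _ _).1 h7
    linarith
  have hV : vor C c = (fun x => x - c) ⁻¹' cell N := by
    ext x
    constructor
    · intro hx a ha
      obtain ⟨c', hc', _, _, rfl⟩ := (hmem a).1 ha
      rw [half_iff, sub_sub_sub_cancel_right]
      exact hx c' hc'
    · intro hx c' hc'
      have h2 := hbd _ hx
      simp only at h2
      by_cases hne : c' = c
      · rw [hne]
      by_cases h5 : ‖c' - c‖ ≤ 5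
      · have := (half_iff _ _).1 (hx _ ((hmem _).2 ⟨c', hc', hne, h5, rfl⟩))
        rwa [sub_sub_sub_cancel_right] at this
      · have := norm_sub_norm_le (c' - c) (x - c)
        rw [sub_sub_sub_cancel_right, norm_sub_rev c' x] at this
        linarith
  have hVB : vor C c ∩ closedBall c l = (fun x => x - c) ⁻¹' (cell N ∩ closedBall 0 l) := by
    rw [hV]
    ext x
    simp [dist_eq_norm]
  rw [hVB, hV]
  simp only [sub_eq_add_neg]
  rw [measure_preimage_add_right, measure_preimage_add_right]
  refine cell_ratio hd ht hl ⟨2, hbd⟩ ?_ ?_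
  · intro a ha
    obtain ⟨c', hc', hne, _, rfl⟩ := (hmem a).1 ha
    exact hC c' hc' c hc hne
  · intro a ha b hb hab
    obtain ⟨c', hc', _, _, rfl⟩ := (hmem a).1 ha
    obtain ⟨c'', hc'', _, _, rfl⟩ := (hmem b).1 hb
    rw [sub_sub_sub_cancel_right]
    exact hC c' hc' c'' hc'' (fun h => hab (by rw [h]))

lemma vor_aedisjoint {C : Set (E d)} {c c' : E d} (hc : c ∈ C) (hc' : c' ∈ C) (h : c ≠ c') :
    AEDisjoint volume (vor C c) (vor C c') := by
  refine measure_mono_null ?_ (hyperplane_null (sub_ne_zero.2 h) ((‖c‖ ^ 2 - ‖c'‖ ^ 2) / 2))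
  rintro x ⟨h1, h2⟩
  have e : ‖x - c‖ = ‖x - c'‖ := le_antisymm (h1 c' hc') (h2 c hc)
  have e2 : ‖x - c‖ ^ 2 = ‖x - c'‖ ^ 2 := by rw [e]
  rw [norm_sub_sq_real, norm_sub_sq_real, real_inner_comm c x,
    real_inner_comm c' x] at e2
  change inner ℝ (c - c') x = _
  rw [inner_sub_left]
  linarith

lemma vor_nearest {C : Set (E d)} (hC : Sep C) (hs : Sat C) (x : E d) :
    ∃ c ∈ C, x ∈ vor C c := by
  obtain ⟨c₀, hc₀, h0⟩ := hs x
  obtain ⟨c, hc, hmin⟩ := Set.exists_min_image (C ∩ closedBall x 2) (fun c => ‖x - c‖)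
    (hC.finite x 2) ⟨c₀, hc₀, by rw [mem_closedBall, dist_comm, dist_eq_norm]; exact h0.le⟩
  refine ⟨c, hc.1, fun c' hc' => ?_⟩
  by_cases h : c' ∈ closedBall x 2
  · exact hmin c' ⟨hc', h⟩
  · rw [mem_closedBall, dist_comm, dist_eq_norm] at h
    have := hmin c₀ ⟨hc₀, by rw [mem_closedBall, dist_comm, dist_eq_norm]; exact h0.le⟩
    linarith

theorem count_bound (hd : 0 < d) {t : Fin (d + 1) → E d} (ht : Reg t) {l : ℝ} (hl : 0 ≤ l)
    {c : ℕ → E d} (hc : ∀ j k : ℕ, j ≠ k → 2 ≤ ‖c j - c k‖) (R : ℝ) :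
    volume ((⋃ i : ℕ, closedBall (c i) l) ∩ closedBall (0 : E d) R) *
        volume (convexHull ℝ (Set.range t)) ≤
      volume (closedBall (0 : E d) (R + 4)) *
        volume (convexHull ℝ (Set.range t) ∩ ⋃ i : Fin (d + 1), closedBall (t i) l) := by
  obtain ⟨C, hsub, hC, hs⟩ := exists_sat (C₀ := Set.range c) (by
    rintro _ ⟨i, rfl⟩ _ ⟨j, rfl⟩ hij
    exact hc i j (fun h => hij (by rw [h])))
  set F := (hC.finite 0 (R + 2)).toFinset with hF
  have hFm : ∀ a, a ∈ F ↔ a ∈ C ∧ ‖a‖ ≤ R + 2 := by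
    intro a; simp [hF]
  have h1 : (⋃ i : ℕ, closedBall (c i) l) ∩ closedBall (0 : E d) R ⊆
      ⋃ a ∈ F, (vor C a ∩ closedBall a l) := by
    rintro x ⟨hx, hxR⟩
    obtain ⟨i, hi⟩ := Set.mem_iUnion.1 hx
    obtain ⟨a, ha, hxa⟩ := vor_nearest hC hs x
    rw [mem_closedBall, dist_eq_norm] at hi hxR
    rw [sub_zero] at hxR
    have h2 := vor_norm hs hxa
    have h3 := norm_sub_norm_le a x
    rw [norm_sub_rev] at h3
    simp only [Set.mem_iUnion]
    refine ⟨a, (hFm a).2 ⟨ha, by linarith⟩, hxa, ?_⟩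
    rw [mem_closedBall, dist_eq_norm]
    exact (hxa (c i) (hsub ⟨i, rfl⟩)).trans hi
  have h2 : ∑ a ∈ F, volume (vor C a) ≤ volume (closedBall (0 : E d) (R + 4)) := by
    rw [← measure_biUnion_finset₀]
    · refine measure_mono ?_
      simp only [Set.iUnion_subset_iff]
      intro a ha x hx
      have h3 := ((hFm a).1 ha).2
      have h4 := vor_norm hs hx
      have h5 := norm_sub_norm_le x a
      rw [mem_closedBall, dist_eq_norm, sub_zero]
      linarith
    · intro a ha b hb hab
      exact vor_aedisjoint ((hFm a).1 ha).1 ((hFm b).1 hb).1 hab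
    · intro a _
      exact (isClosed_vor C a).measurableSet.nullMeasurableSet
  calc _ ≤ (∑ a ∈ F, volume (vor C a ∩ closedBall a l)) * volume (convexHull ℝ (Set.range t)) :=
        mul_le_mul' ((measure_mono h1).trans (measure_biUnion_finset_le _ _)) le_rfl
    _ ≤ (∑ a ∈ F, volume (vor C a)) *
        volume (convexHull ℝ (Set.range t) ∩ ⋃ i : Fin (d + 1), closedBall (t i) l) := by
      rw [Finset.sum_mul, Finset.sum_mul]
      exact Finset.sum_le_sum fun a ha => vor_ratio hd ht hl hC hs ((hFm a).1 ha).1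
    _ ≤ _ := mul_le_mul' h2 le_rfl


/-! ### Volume of the simplex and the final limit -/

lemma Reg.affineIndependent {t : Fin (d + 1) → E d} (ht : Reg t) : AffineIndependent ℝ t := by
  rw [affineIndependent_iff]
  intro s w hw hwt i hi
  have := ht.unique (b := fun i => if i ∈ s then w i else 0) (by simpa using hw)
    (by simpa [ite_smul] using hwt) i
  simpa [hi] using this

lemma Reg.span {t : Fin (d + 1) → E d} (ht : Reg t) : affineSpan ℝ (Set.range t) = ⊤ := by
  rw [ht.affineIndependent.affineSpan_eq_top_iff_card_eq_finrank_add_one]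
  simp

lemma Reg.center {t : Fin (d + 1) → E d} (ht : Reg t) :
    ∃ m ∈ interior (convexHull ℝ (Set.range t)), ∀ i, ‖m - t i‖ ^ 2 = 2 * d / (d + 1) := by
  let b : AffineBasis (Fin (d + 1)) ℝ (E d) := ⟨t, ht.affineIndependent, ht.span⟩
  have hm : Finset.univ.centroid ℝ t ∈ interior (convexHull ℝ (Set.range t)) :=
    b.centroid_mem_interior_convexHull
  refine ⟨_, hm, fun i => ?_⟩
  have e : Finset.univ.centroid ℝ t = ∑ j, ((d : ℝ) + 1)⁻¹ • t j := by
    rw [Finset.centroid_def, Finset.affineCombination_eq_linear_combination]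
    · simp [Finset.centroidWeights]
    · exact Finset.sum_centroidWeights_eq_one_of_nonempty ℝ _ Finset.univ_nonempty
  have e2 : Finset.univ.centroid ℝ t - t i = ((d : ℝ) + 1)⁻¹ • ∑ j, (t j - t i) := by
    rw [e, Finset.sum_sub_distrib, smul_sub, Finset.smul_sum]
    congr 1
    rw [Finset.sum_const, ← Nat.cast_smul_eq_nsmul ℝ, smul_smul]
    simp
    rw [inv_mul_cancel₀ (by positivity), one_smul]
  rw [e2, norm_smul, mul_pow, ← real_inner_self_eq_norm_sq (∑ j, (t j - t i)), sum_inner]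
  simp_rw [inner_sum, ht.inner_eq, ← Finset.mul_sum, Finset.sum_add_distrib,
    Finset.sum_sub_distrib, Finset.sum_ite_eq]
  simp
  field_simp

lemma isCompact_hull (t : Fin (d + 1) → E d) : IsCompact (convexHull ℝ (Set.range t)) :=
  (Set.finite_range t).isCompact_convexHull (𝕜 := ℝ)

lemma Reg.vol_pos {t : Fin (d + 1) → E d} (ht : Reg t) :
    0 < (volume (convexHull ℝ (Set.range t))).toReal := by
  obtain ⟨m, hm, _⟩ := ht.center
  refine ENNReal.toReal_pos ?_ (isCompact_hull t).measure_lt_top.ne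
  exact (Measure.measure_pos_of_nonempty_interior _ ⟨m, hm⟩).ne'

lemma Reg.ratio_lt {t : Fin (d + 1) → E d} (ht : Reg t) {l : ℝ} (hl : 0 ≤ l)
    (hl2 : l ^ 2 < 2 * d / (d + 1)) :
    (volume (convexHull ℝ (Set.range t) ∩
        ⋃ i : Fin (d + 1), closedBall (t i) l)).toReal /
      (volume (convexHull ℝ (Set.range t))).toReal < 1 := by
  rw [div_lt_one ht.vol_pos]
  set T := convexHull ℝ (Set.range t) with hT
  have hfin : volume T ≠ ⊤ := (isCompact_hull t).measure_lt_top.ne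
  set B := ⋃ i : Fin (d + 1), closedBall (t i) l with hB
  have hBc : IsClosed B := isClosed_iUnion_of_finite fun i => isClosed_closedBall
  obtain ⟨m, hm, hmi⟩ := ht.center
  have hpos : 0 < volume (T \ B) := by
    have ho : IsOpen (interior T \ B) := isOpen_interior.sdiff hBc
    have : 0 < volume (interior T \ B) := by
      refine ho.measure_pos _ ⟨m, hm, ?_⟩
      simp only [hB, Set.mem_iUnion, mem_closedBall, not_exists, not_le]
      intro i
      rw [dist_eq_norm]
      refine (sq_lt_sq₀ hl (norm_nonneg _)).1 ?_
      rw [hmi i]; exact hl2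
    exact this.trans_le (measure_mono (Set.sdiff_subset_sdiff_left interior_subset))
  have hadd := measure_inter_add_sdiff (μ := volume) T hBc.measurableSet
  have hne : volume (T ∩ B) ≠ ⊤ := ((measure_mono Set.inter_subset_left).trans_lt hfin.lt_top).ne
  refine (ENNReal.toReal_lt_toReal hne hfin).2 ?_
  rw [← hadd]
  exact ENNReal.lt_add_right hne hpos.ne'

theorem limsup_bound (hd : 0 < d) {t : Fin (d + 1) → E d} (ht : Reg t) {l : ℝ} (hl : 0 ≤ l)
    {c : ℕ → E d} (hc : ∀ j k : ℕ, j ≠ k → 2 ≤ ‖c j - c k‖) :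
    Filter.limsup (fun R : ℝ =>
          (volume ((⋃ i : ℕ, closedBall (c i) l) ∩ closedBall (0 : E d) R)).toReal /
          (volume (closedBall (0 : E d) R)).toReal) Filter.atTop ≤
        (volume (convexHull ℝ (Set.range t) ∩
            ⋃ i : Fin (d + 1), closedBall (t i) l)).toReal /
          (volume (convexHull ℝ (Set.range t))).toReal := by
  set σ := (volume (convexHull ℝ (Set.range t) ∩
            ⋃ i : Fin (d + 1), closedBall (t i) l)).toReal /
          (volume (convexHull ℝ (Set.range t))).toReal with hσ
  have hT := ht.vol_pos
  have hTtop : volume (convexHull ℝ (Set.range t)) ≠ ⊤ := (isCompact_hull t).measure_lt_top.ne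
  have hlim : Filter.Tendsto (fun R : ℝ => (1 + 4 / R) ^ d * σ) Filter.atTop (nhds σ) := by
    have h1 : Filter.Tendsto (fun R : ℝ => 4 / R) Filter.atTop (nhds 0) :=
      Filter.Tendsto.div_atTop tendsto_const_nhds Filter.tendsto_id
    have := ((h1.const_add 1).pow d).mul_const σ
    simpa using this
  rw [← hlim.limsup_eq]
  refine Filter.limsup_le_limsup ?_ ?_ hlim.isBoundedUnder_le
  · filter_upwards [Filter.eventually_gt_atTop 0] with R hR
    have hcb := count_bound hd ht hl hc R
    have hv : ∀ r : ℝ, 0 ≤ r → (volume (closedBall (0 : E d) r)).toReal =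
        r ^ d * (volume (ball (0 : E d) 1)).toReal := by
      intro r hr
      rw [Measure.addHaar_closedBall _ _ hr, ENNReal.toReal_mul, ENNReal.toReal_ofReal (by positivity)]
      simp
    have hω : 0 < (volume (ball (0 : E d) 1)).toReal :=
      ENNReal.toReal_pos (measure_ball_pos _ _ one_pos).ne' measure_ball_lt_top.ne
    have hreal := ENNReal.toReal_mono (ENNReal.mul_ne_top measure_closedBall_lt_top.ne
      ((measure_mono Set.inter_subset_left).trans_lt hTtop.lt_top).ne) hcb
    rw [ENNReal.toReal_mul, ENNReal.toReal_mul, hv (R + 4) (by linarith)] at hreal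
    rw [hv R hR.le, div_le_iff₀ (by positivity)]
    rw [← le_div_iff₀ hT] at hreal
    refine hreal.trans (le_of_eq ?_)
    have e : (1 + 4 / R) ^ d * R ^ d = (R + 4) ^ d := by
      rw [← mul_pow]; congr 1; field_simp
    rw [hσ, ← e]
    ring
  · exact Filter.IsCoboundedUnder.of_frequently_ge (a := 0)
      (Filter.Frequently.of_forall fun R => by positivity)


end SoftBall

/-- Rogers-type bound for soft ball packings: for `d ≥ 2`, `0 ≤ λ < √(2d/(d+1)) - 1`,
`ℓ = 1 + λ`, and a regular `d`-simplex `T^d = conv{t 1, …, t (d+1)}` of edge length `2`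
in `E^d`, setting `σ̄_d(λ) = vol_d(T^d ∩ ⋃ (t i + ℓB^d)) / vol_d(T^d)`, the upper density
of the outer parallel domain (of outer radius `λ`) of every infinite packing of unit balls
in `E^d` is at most `σ̄_d(λ)`; moreover `σ̄_d(λ) < 1`. -/
theorem soft_ball_density_le_simplex_bound (d : ℕ) (hd : 2 ≤ d) (lam : ℝ) (hlam0 : 0 ≤ lam)
    (hlam1 : lam < Real.sqrt (2 * d / (d + 1)) - 1)
    (t : Fin (d + 1) → EuclideanSpace ℝ (Fin d))
    (ht : ∀ i j : Fin (d + 1), i ≠ j → ‖t i - t j‖ = 2) :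
    (∀ c : ℕ → EuclideanSpace ℝ (Fin d),
      (∀ j k : ℕ, j ≠ k → 2 ≤ ‖c j - c k‖) →
      Filter.limsup (fun R : ℝ =>
          (volume ((⋃ i : ℕ, closedBall (c i) (1 + lam)) ∩
            closedBall (0 : EuclideanSpace ℝ (Fin d)) R)).toReal /
          (volume (closedBall (0 : EuclideanSpace ℝ (Fin d)) R)).toReal) Filter.atTop ≤
        (volume (convexHull ℝ (Set.range t) ∩
            ⋃ i : Fin (d + 1), closedBall (t i) (1 + lam))).toReal /
          (volume (convexHull ℝ (Set.range t))).toReal) ∧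
    (volume (convexHull ℝ (Set.range t) ∩
        ⋃ i : Fin (d + 1), closedBall (t i) (1 + lam))).toReal /
      (volume (convexHull ℝ (Set.range t))).toReal < 1 := by
  have hl2 : (1 + lam) ^ 2 < 2 * d / (d + 1) := (Real.lt_sqrt (by linarith)).1 (by linarith)
  exact ⟨fun c hc => SoftBall.limsup_bound (by omega) ht (by linarith) hc,
    SoftBall.Reg.ratio_lt ht (by linarith) hl2⟩
end
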